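/- arXiv:0805.2033 — 10 statements merged into one kernel-verified Lean document; each statement's English description precedes it below -/
import Mathlib

section
/- Let X be a countable infinite set, 𝒜 ⊆ 𝒫∞(X) a hereditary family, and B ∈ 𝒫∞(X). Then B ∈ 𝒜^{⊥⊥} if and only if for every infinite subset C of B there exists an infinite subset A of C with A ∈ 𝒜. -/
open Set

/-- The characteristic function of a set, viewing `2^X` as `X → Bool`. -/
noncomputable def chi {X : Type*} (A : Set X) : X → Bool :=
  fun x => @decide (x ∈ A) (Classical.dec _)

/-- `𝒫∞(X)`: the family of all infinite subsets of `X`. -/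
def PInf (X : Type*) : Set (Set X) := {A | A.Infinite}

/-- A family of infinite sets is hereditary if every infinite subset of a member is a member. -/
def Hered {X : Type*} (F : Set (Set X)) : Prop :=
  ∀ A ∈ F, ∀ B ⊆ A, B.Infinite → B ∈ F

/-- Two families are orthogonal if `A ∩ B` is finite for all `A ∈ F`, `B ∈ G`. -/
def OrthFam {X : Type*} (F G : Set (Set X)) : Prop :=
  ∀ A ∈ F, ∀ B ∈ G, (A ∩ B).Finite

/-- The orthogonal `F^⊥` of a family `F`. -/
def perp {X : Type*} (F : Set (Set X)) : Set (Set X) :=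
  {B | B.Infinite ∧ ∀ A ∈ F, (B ∩ A).Finite}

/-- A hereditary family `F` is an M-family if for every sequence `(A n)` in `F` there is
`B ∈ F` all but finitely many of whose elements lie in `⋃_{i ≥ n} A i`, for every `n`. -/
def MFamily {X : Type*} (F : Set (Set X)) : Prop :=
  Hered F ∧ ∀ A : ℕ → Set X, (∀ n, A n ∈ F) →
    ∃ B ∈ F, ∀ n : ℕ, (B \ ⋃ i : ℕ, ⋃ _ : n ≤ i, A i).Finite

/-- `F` is countably generated in `G`. -/
def CountGen {X : Type*} (F G : Set (Set X)) : Prop :=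
  ∃ B : ℕ → Set X, (∀ n, B n ∈ G) ∧ ∀ A ∈ F, ∃ n, (A \ B n).Finite

/-- The C-measurable sets: the smallest σ-algebra containing the open sets and closed
under the Souslin operation. -/
inductive CMeas {α : Type*} [TopologicalSpace α] : Set α → Prop
  | isOpen (s : Set α) : IsOpen s → CMeas s
  | compl (s : Set α) : CMeas s → CMeas sᶜ
  | iUnion (f : ℕ → Set α) : (∀ n, CMeas (f n)) → CMeas (⋃ n, f n)
  | souslin (P : List ℕ → Set α) : (∀ s, CMeas (P s)) →
      CMeas (⋃ σ : ℕ → ℕ, ⋂ n : ℕ, P (List.ofFn fun i : Fin n => σ i))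

/-- A family of subsets of `X` is analytic if its image in `2^X = X → Bool` under
characteristic functions is an analytic set. -/
def AnalyticFam {X : Type*} (F : Set (Set X)) : Prop :=
  MeasureTheory.AnalyticSet (chi '' F : Set (X → Bool))

/-- A family of subsets of `X` is C-measurable if its image in `2^X = X → Bool` is. -/
def CMeasFam {X : Type*} (F : Set (Set X)) : Prop :=
  CMeas (chi '' F : Set (X → Bool))

/-- A perfect Lusin gap inside the pair `(F, G)`. -/
def PerfectLusinGap (F G : Set (Set ℕ)) : Prop :=
  ∃ A B : (ℕ → Bool) → Set ℕ,
    Continuous (fun x => (chi (A x), chi (B x))) ∧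
    Function.Injective (fun x => (A x, B x)) ∧
    (∀ x, A x ∈ F) ∧ (∀ x, B x ∈ G) ∧
    (∀ x, A x ∩ B x = ∅) ∧
    (∀ x y, x ≠ y → ((A x ∩ B y) ∪ (A y ∩ B x)).Nonempty)

theorem stmt3 {X : Type*} [Countable X] [Infinite X]
    (𝒜 : Set (Set X)) (h𝒜P : 𝒜 ⊆ PInf X) (h𝒜her : Hered 𝒜)
    (B : Set X) (hB : B.Infinite) :
    B ∈ perp (perp 𝒜) ↔
      ∀ C ⊆ B, C.Infinite → ∃ A ⊆ C, A.Infinite ∧ A ∈ 𝒜 := by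
  constructor
  · rintro ⟨-, h⟩ C hCB hC
    by_contra hno
    have hCp : C ∈ perp 𝒜 := by
      refine ⟨hC, fun A hA => ?_⟩
      by_contra hinf
      exact hno ⟨C ∩ A, inter_subset_left, hinf,
        h𝒜her A hA _ inter_subset_right hinf⟩
    exact hC ((h C hCp).subset (subset_inter hCB subset_rfl))
  · intro h
    refine ⟨hB, fun D hD => ?_⟩
    by_contra hinf
    obtain ⟨A, hAs, hAi, hA⟩ := h (B ∩ D) inter_subset_left hinf
    exact hAi ((hD.2 A hA).subset
      (subset_inter (hAs.trans inter_subset_right) subset_rfl))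
end

section
/- Let X be a countable infinite set and 𝒜 ⊆ 𝒫∞(X) a hereditary family. The following are equivalent: (i) 𝒜 is an M-family; (ii) for every decreasing sequence (D_n) in co(𝒜) there exists A ∈ 𝒜 with A ⊆* D_n for every n ∈ ℕ; (iii) for every sequence (A_n) in 𝒜 there exists A ∈ 𝒜 such that A ∩ A_n ≠ ∅ for infinitely many n ∈ ℕ. -/
open Set

/-- The co-ideal generated by a family `F`: infinite sets meeting some member of `F`
in an infinite set. -/
def coFam {X : Type*} (F : Set (Set X)) : Set (Set X) :=
  {B | B.Infinite ∧ ∃ A ∈ F, (A ∩ B).Infinite}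

/-- An ideal on `X`: a hereditary family of infinite subsets closed under finite unions. -/
def IsIdealOn {X : Type*} (I : Set (Set X)) : Prop :=
  I ⊆ PInf X ∧ Hered I ∧ ∀ A ∈ I, ∀ B ∈ I, A ∪ B ∈ I

/-- `p* = {A ∈ 𝒫∞(X) : X \ A ∈ p}` for an ultrafilter `p` on `X`. -/
def pstar {X : Type*} (p : Ultrafilter X) : Set (Set X) :=
  {A | A.Infinite ∧ Aᶜ ∈ p}

/-- An ideal `I` is bisequential if for every ultrafilter `p` with `I ⊆ p*`,
the family `I` is countably generated in `p*`. -/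
def Bisequential {X : Type*} (I : Set (Set X)) : Prop :=
  ∀ p : Ultrafilter X, I ⊆ pstar p → CountGen I (pstar p)

theorem stmt5 {X : Type*} [Countable X] [Infinite X]
    (𝒜 : Set (Set X)) (h𝒜P : 𝒜 ⊆ PInf X) (h𝒜her : Hered 𝒜) :
    (MFamily 𝒜 ↔
      ∀ D : ℕ → Set X, Antitone D → (∀ n, D n ∈ coFam 𝒜) →
        ∃ A ∈ 𝒜, ∀ n, (A \ D n).Finite) ∧
    (MFamily 𝒜 ↔
      ∀ A : ℕ → Set X, (∀ n, A n ∈ 𝒜) →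
        ∃ B ∈ 𝒜, {n : ℕ | (B ∩ A n).Nonempty}.Infinite) := by
  refine ⟨⟨?_, ?_⟩, ⟨?_, ?_⟩⟩
  · rintro ⟨-, hM⟩ D hD hco
    choose hinf A hA hAD using hco
    obtain ⟨B, hB, hfin⟩ := hM (fun n => A n ∩ D n)
      (fun n => h𝒜her _ (hA n) _ inter_subset_left (hAD n))
    refine ⟨B, hB, fun n => (hfin n).subset ?_⟩
    refine diff_subset_diff_right ?_
    exact iUnion₂_subset fun i hi x hx => hD hi hx.2
  · intro h
    refine ⟨h𝒜her, fun A hA => ?_⟩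
    refine h (fun n => ⋃ i : ℕ, ⋃ _ : n ≤ i, A i) ?_ ?_
    · intro m n hmn
      refine iUnion₂_subset fun i hi x hx => ?_
      exact mem_iUnion₂.2 ⟨i, le_trans hmn hi, hx⟩
    · intro n
      have hsub : A n ⊆ ⋃ i : ℕ, ⋃ _ : n ≤ i, A i :=
        fun x hx => mem_iUnion₂.2 ⟨n, le_rfl, hx⟩
      have hi : (A n).Infinite := h𝒜P (hA n)
      refine ⟨hi.mono hsub, A n, hA n, ?_⟩
      rwa [inter_eq_left.2 hsub]
  · rintro ⟨-, hM⟩ A hA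
    obtain ⟨B, hB, hfin⟩ := hM A hA
    refine ⟨B, hB, ?_⟩
    have hBi : B.Infinite := h𝒜P hB
    refine infinite_of_not_bddAbove ?_
    rintro ⟨N, hN⟩
    refine hBi ((hfin (N + 1)).subset ?_)
    intro x hx
    refine ⟨hx, fun hmem => ?_⟩
    obtain ⟨i, hi, hxi⟩ := mem_iUnion₂.1 hmem
    have : i ≤ N := hN ⟨x, hx, hxi⟩
    omega
  · intro h
    refine ⟨h𝒜her, fun A hA => ?_⟩
    obtain ⟨f, hf⟩ := exists_injective_nat X
    obtain ⟨B, hB, hinf⟩ := h (fun n => A n \ f ⁻¹' (Iio n)) (fun n =>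
      h𝒜her _ (hA n) _ diff_subset
        (Infinite.diff (h𝒜P (hA n)) ((finite_Iio n).preimage hf.injOn)))
    have hx : ∀ n : {n : ℕ | (B ∩ (A n \ f ⁻¹' (Iio n))).Nonempty},
      ∃ x, x ∈ B ∩ (A n \ f ⁻¹' (Iio n.1)) := fun n => n.2
    choose x hx using hx
    refine ⟨range x, h𝒜her _ hB _ ?_ ?_, fun m => ?_⟩
    · rintro _ ⟨n, rfl⟩
      exact (hx n).1
    · intro hfin
      obtain ⟨N, hN⟩ := (hfin.image f).bddAbove
      refine hinf ((finite_Iic N).subset fun n hn => ?_)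
      have h1 : f (x ⟨n, hn⟩) ≤ N := hN ⟨_, ⟨⟨n, hn⟩, rfl⟩, rfl⟩
      have h2 := (hx ⟨n, hn⟩).2.2
      simp only [mem_preimage, mem_Iio, not_lt] at h2
      exact le_trans h2 h1
    · refine (((finite_Iio m).preimage Subtype.val_injective.injOn).image x).subset ?_
      rintro _ ⟨⟨n, rfl⟩, hn⟩
      refine ⟨n, ?_, rfl⟩
      simp only [mem_preimage, mem_Iio]
      by_contra hlt
      exact hn (mem_iUnion₂.2 ⟨n, not_lt.1 hlt, (hx n).2.1⟩)
end

section
/- Let 𝒜 be a hereditary family of infinite subsets of ℕ. Then 𝒜 is an M-family if and only if the co-ideal co(𝒜) is selective, i.e. for every decreasing sequence (D_n) in co(𝒜) there exists D ∈ co(𝒜) such that D \ {0, 1, ..., n} ⊆ D_n for all n ∈ D. -/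
open Set

theorem stmt6 (𝒜 : Set (Set ℕ)) (h𝒜P : 𝒜 ⊆ PInf ℕ) (h𝒜her : Hered 𝒜) :
    MFamily 𝒜 ↔
      ∀ D : ℕ → Set ℕ, Antitone D → (∀ n, D n ∈ coFam 𝒜) →
        ∃ E ∈ coFam 𝒜, ∀ n ∈ E, ∀ m ∈ E, n < m → m ∈ D n := by
  constructor
  · rintro ⟨-, hM⟩ D hD hco
    choose hinf A hA hAD using hco
    obtain ⟨B, hB, hfin⟩ := hM (fun n => A n ∩ D n)
      (fun n => h𝒜her _ (hA n) _ inter_subset_left (hAD n))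
    have hBinf : B.Infinite := h𝒜P hB
    have h1 : ∀ k : ℕ, ∃ g : ℕ, k < g ∧ ∀ m ∈ B, g ≤ m → m ∈ D k := by
      intro k
      obtain ⟨b, hb⟩ := (hfin k).bddAbove
      refine ⟨max b k + 1, by omega, fun m hm hgm => ?_⟩
      by_contra hmD
      have : m ≤ b := by
        apply hb
        refine ⟨hm, fun hU => hmD ?_⟩
        simp only [mem_iUnion] at hU
        obtain ⟨i, hi, hmi⟩ := hU
        exact hD hi hmi.2
      omega
    choose g hg1 hg2 using h1
    have h2 : ∀ k : ℕ, ∃ m ∈ B, g k < m := fun k => hBinf.exists_gt (g k)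
    choose h hhB hgh using h2
    let f : ℕ → ℕ := fun i => Nat.rec (h 0) (fun _ x => h x) i
    have hf : ∀ i, f (i + 1) = h (f i) := fun i => rfl
    have hfB : ∀ i, f i ∈ B := by
      intro i
      cases i with
      | zero => exact hhB 0
      | succ i => rw [hf]; exact hhB _
    have hmono : StrictMono f := strictMono_nat_of_lt_succ fun i => by
      rw [hf]; exact (hg1 _).trans (hgh _)
    have hEinf : (range f).Infinite := infinite_range_of_injective hmono.injective
    have hEB : range f ⊆ B := by rintro _ ⟨i, rfl⟩; exact hfB i
    refine ⟨range f, ⟨hEinf, B, hB, by rwa [inter_eq_self_of_subset_right hEB]⟩, ?_⟩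
    rintro _ ⟨i, rfl⟩ _ ⟨j, rfl⟩ hij
    have hij' : i + 1 ≤ j := hmono.lt_iff_lt.1 hij
    refine hg2 _ _ (hfB j) ?_
    have h3 := hmono.monotone hij'
    rw [hf] at h3
    exact (hgh _).le.trans h3
  · intro hS
    refine ⟨h𝒜her, fun A hA => ?_⟩
    have hsub : ∀ n, A n ⊆ ⋃ i : ℕ, ⋃ _ : n ≤ i, A i := fun n x hx => by
      simp only [mem_iUnion]
      exact ⟨n, le_rfl, hx⟩
    have hanti : Antitone (fun n => ⋃ i : ℕ, ⋃ _ : n ≤ i, A i) := by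
      intro a b hab x hx
      simp only [mem_iUnion] at hx ⊢
      obtain ⟨i, hi, hx⟩ := hx
      exact ⟨i, hab.trans hi, hx⟩
    obtain ⟨E, ⟨-, C, hC, hCE⟩, hE⟩ := hS _ hanti (fun n =>
      ⟨(h𝒜P (hA n)).mono (hsub n), A n, hA n, by
        rw [inter_eq_self_of_subset_left (hsub n)]; exact h𝒜P (hA n)⟩)
    refine ⟨C ∩ E, h𝒜her _ hC _ inter_subset_left hCE, fun n => ?_⟩
    obtain ⟨k, hk, hnk⟩ := hCE.exists_gt n
    refine (finite_Iic k).subset ?_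
    rintro m ⟨hm, hmn⟩
    by_contra hmk
    exact hmn (hanti hnk.le (hE k hk.2 m hm.2 (not_le.1 hmk)))
end

section
/- Let X be a countable infinite set and 𝒜 ⊆ 𝒫∞(X) a hereditary family. If the ideal 𝒜^⊥ is bisequential, then 𝒜 is an M-family. -/
open Set

/-- Pseudo-intersections of decreasing sequences of infinite sets. -/
theorem pseudo_inter {X : Type*} (V : ℕ → Set X) (hanti : Antitone V)
    (hinf : ∀ n, (V n).Infinite) :
    ∃ D : Set X, D.Infinite ∧ ∀ n, (D \ V n).Finite := by
  classical
  obtain ⟨f, hf, hr⟩ := exists_seq_of_forall_finset_exists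
    (fun q : ℕ × X => q.2 ∈ V q.1) (fun q r => q.1 < r.1 ∧ q.2 ≠ r.2) (by
      intro s _
      obtain ⟨y, hy, hys⟩ := (hinf (s.sup Prod.fst + 1)).exists_notMem_finset (s.image Prod.snd)
      refine ⟨(s.sup Prod.fst + 1, y), hy, fun x hx => ⟨?_, ?_⟩⟩
      · exact Nat.lt_succ_of_le (Finset.le_sup (f := Prod.fst) hx)
      · rintro rfl
        exact hys (Finset.mem_image_of_mem _ hx))
  have hmono : StrictMono (fun n => (f n).1) := fun m n h => (hr m n h).1
  have hinj : Function.Injective (fun n => (f n).2) := by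
    intro m n h
    rcases lt_trichotomy m n with h1 | h1 | h1
    · exact absurd h (hr m n h1).2
    · exact h1
    · exact absurd h.symm (hr n m h1).2
  refine ⟨Set.range fun n => (f n).2, Set.infinite_range_of_injective hinj, fun n => ?_⟩
  refine ((Set.finite_lt_nat n).image (fun n => (f n).2)).subset ?_
  rintro _ ⟨⟨k, rfl⟩, hk⟩
  refine ⟨k, ?_, rfl⟩
  by_contra hkn
  have h1 : n ≤ k := not_lt.mp hkn
  exact hk (hanti (h1.trans (hmono.le_apply (x := k))) (hf k))

theorem stmt7 {X : Type*} [Countable X] [Infinite X]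
    (𝒜 : Set (Set X)) (h𝒜P : 𝒜 ⊆ PInf X) (h𝒜her : Hered 𝒜)
    (hbi : Bisequential (perp 𝒜)) :
    MFamily 𝒜 := by
  refine ⟨h𝒜her, fun A hA => ?_⟩
  set U : ℕ → Set X := fun n => ⋃ i : ℕ, ⋃ _ : n ≤ i, A i with hU
  have hUanti : Antitone U := by
    intro m n hmn x hx
    simp only [hU, Set.mem_iUnion] at hx ⊢
    obtain ⟨i, hi, hx⟩ := hx
    exact ⟨i, hmn.trans hi, hx⟩
  have hAU : ∀ n, A n ⊆ U n := by
    intro n x hx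
    simp only [hU, Set.mem_iUnion]
    exact ⟨n, le_rfl, hx⟩
  let F : Filter X :=
    { sets := {S | ∃ n, ∃ C : Set X, (∀ E ∈ 𝒜, (C ∩ E).Finite) ∧ U n \ C ⊆ S}
      univ_sets := ⟨0, ∅, fun E _ => by simp, Set.subset_univ _⟩
      sets_of_superset := by
        rintro S T ⟨n, C, hC, h⟩ hST
        exact ⟨n, C, hC, h.trans hST⟩
      inter_sets := by
        rintro S T ⟨n, C, hC, h⟩ ⟨m, C2, hC2, h2⟩
        refine ⟨max n m, C ∪ C2, fun E hE => ?_, fun x hx => ⟨h ⟨?_, ?_⟩, h2 ⟨?_, ?_⟩⟩⟩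
        · rw [Set.union_inter_distrib_right]
          exact (hC E hE).union (hC2 E hE)
        · exact hUanti (le_max_left _ _) hx.1
        · exact fun hc => hx.2 (Or.inl hc)
        · exact hUanti (le_max_right _ _) hx.1
        · exact fun hc => hx.2 (Or.inr hc) }
  have hFmem : ∀ S, S ∈ F ↔ ∃ n, ∃ C : Set X, (∀ E ∈ 𝒜, (C ∩ E).Finite) ∧ U n \ C ⊆ S :=
    fun S => Iff.rfl
  have hne : F.NeBot := by
    rw [← Filter.empty_mem_iff_bot.not.trans Filter.neBot_iff.symm, hFmem]
    rintro ⟨n, C, hC, h⟩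
    refine h𝒜P (hA n) ((hC _ (hA n)).subset fun x hx => ⟨?_, hx⟩)
    by_contra hxC
    exact h ⟨hAU n hx, hxC⟩
  let p : Ultrafilter X := Ultrafilter.of F
  have hpF : ∀ S ∈ F, S ∈ p := fun S hS => Ultrafilter.of_le F hS
  have hpC : ∀ C : Set X, (∀ E ∈ 𝒜, (C ∩ E).Finite) → Cᶜ ∈ p := fun C hC =>
    hpF _ ⟨0, C, hC, fun x hx => hx.2⟩
  have hpU : ∀ n, U n ∈ p := fun n => hpF _ ⟨n, ∅, fun E _ => by simp, fun x hx => hx.1⟩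
  have hpinf : ∀ V ∈ p, V.Infinite := fun V hV hfin =>
    (Ultrafilter.compl_mem_iff_notMem.mp (hpC V fun E _ => hfin.inter_of_left E)) hV
  obtain ⟨B, hB, hgen⟩ := hbi p (fun C hC => ⟨hC.1, hpC C hC.2⟩)
  let V : ℕ → Set X := fun n => U n ∩ ⋂ i ∈ Set.Iic n, (B i)ᶜ
  have hVp : ∀ n, V n ∈ p := fun n =>
    Filter.inter_mem (hpU n) ((Filter.biInter_mem (Set.finite_Iic n)).mpr fun i _ => (hB i).2)
  have hVanti : Antitone V := by
    intro m n hmn x hx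
    refine ⟨hUanti hmn hx.1, ?_⟩
    have h2 := hx.2
    simp only [Set.mem_iInter] at h2 ⊢
    exact fun i hi => h2 i (le_trans hi hmn)
  obtain ⟨D, hD, hDV⟩ := pseudo_inter V hVanti fun n => hpinf _ (hVp n)
  by_cases h : ∃ E ∈ 𝒜, (D ∩ E).Infinite
  · obtain ⟨E, hE, hDE⟩ := h
    refine ⟨D ∩ E, h𝒜her E hE _ Set.inter_subset_right hDE, fun n => ?_⟩
    exact (hDV n).subset fun x hx => ⟨hx.1.1, fun hv => hx.2 hv.1⟩
  · exfalso
    obtain ⟨n, hn⟩ := hgen D ⟨hD, fun E hE => by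
      by_contra hc
      exact h ⟨E, hE, hc⟩⟩
    refine hD ((hn.union (hDV n)).subset fun x hx => ?_)
    by_cases hxB : x ∈ B n
    · refine Or.inr ⟨hx, fun hv => ?_⟩
      have h2 := hv.2
      simp only [Set.mem_iInter] at h2
      exact h2 n (Set.mem_Iic.mpr le_rfl) hxB
    · exact Or.inl ⟨hx, hxB⟩
end

section
/- Let X be a countable infinite set and ℐ an ideal on X. If ℐ is bisequential, then ℐ^⊥ is an M-family. -/
open Set

theorem pseudo_aux {X : Type*} [Countable X] (D : ℕ → Set X) (hD : Antitone D)
    (hinf : ∀ n, (D n).Infinite) :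
    ∃ B : Set X, B.Infinite ∧ ∀ n, (B \ D n).Finite := by
  obtain ⟨e, he⟩ := exists_injective_nat X
  obtain ⟨φ, hφ, h⟩ := Filter.extraction_forall_of_frequently
    (P := fun n k => k ∈ e '' D n) (fun n => by
      rw [Nat.frequently_atTop_iff_infinite]
      exact (hinf n).image he.injOn)
  choose x hx hxe using h
  have hxi : Function.Injective x := fun a b hab => hφ.injective (by rw [← hxe, ← hxe, hab])
  refine ⟨Set.range x, Set.infinite_range_of_injective hxi, fun n => ?_⟩
  refine ((Set.finite_lt_nat n).image x).subset ?_
  rintro _ ⟨⟨m, rfl⟩, hm⟩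
  refine ⟨m, ?_, rfl⟩
  by_contra hlt
  exact hm (hD (not_lt.mp hlt) (hx m))

theorem stmt8 {X : Type*} [Countable X] [Infinite X]
    (I : Set (Set X)) (hI : IsIdealOn I) (hbi : Bisequential I) :
    MFamily (perp I) := by
  obtain ⟨hinf, hher, hun⟩ := hI
  refine ⟨fun A hA B hB hBi => ⟨hBi, fun J hJ => (hA.2 J hJ).subset
    (Set.inter_subset_inter_left _ hB)⟩, fun A hA => ?_⟩
  set C : ℕ → Set X := fun n => ⋃ i : ℕ, ⋃ _ : n ≤ i, A i with hC
  have hCanti : Antitone C := by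
    intro m n hmn x hx
    simp only [hC, Set.mem_iUnion] at hx ⊢
    obtain ⟨i, hi, hx⟩ := hx
    exact ⟨i, hmn.trans hi, hx⟩
  have hAC : ∀ n, A n ⊆ C n := by
    intro n x hx
    simp only [hC, Set.mem_iUnion]
    exact ⟨n, le_rfl, hx⟩
  have hne : ∀ n J, (J = ∅ ∨ J ∈ I) → (C n \ J).Infinite := by
    intro n J hJ hfin
    have h1 : (A n ∩ J).Finite := by
      rcases hJ with rfl | hJ
      · simp
      · exact (hA n).2 J hJ
    refine (hA n).1 ((h1.union hfin).subset fun x hx => ?_)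
    by_cases hxJ : x ∈ J
    · exact Or.inl ⟨hx, hxJ⟩
    · exact Or.inr ⟨hAC n hx, hxJ⟩
  let F : Filter X :=
    { sets := {s | ∃ n J, (J = ∅ ∨ J ∈ I) ∧ ((C n \ J) \ s).Finite}
      univ_sets := ⟨0, ∅, Or.inl rfl, by simp⟩
      sets_of_superset := by
        rintro s t ⟨n, J, hJ, hf⟩ hst
        exact ⟨n, J, hJ, hf.subset (Set.diff_subset_diff_right hst)⟩
      inter_sets := by
        rintro s t ⟨n, J, hJ, hf⟩ ⟨m, K, hK, hg⟩
        refine ⟨max n m, J ∪ K, ?_, (hf.union hg).subset ?_⟩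
        · rcases hJ with rfl | hJ
          · simpa using hK
          · rcases hK with rfl | hK
            · right; simpa using hJ
            · exact Or.inr (hun J hJ K hK)
        · rintro x ⟨⟨hx, hxJ⟩, hxs⟩
          have h1 := hCanti (le_max_left n m) hx
          have h2 := hCanti (le_max_right n m) hx
          simp only [Set.mem_union, Set.mem_inter_iff, Set.mem_diff] at *
          tauto }
  have hF : ∀ s, s ∈ F ↔ ∃ n J, (J = ∅ ∨ J ∈ I) ∧ ((C n \ J) \ s).Finite := fun s => Iff.rfl
  haveI : F.NeBot := by
    refine ⟨fun hbot => ?_⟩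
    have : (∅ : Set X) ∈ F := by rw [hbot]; exact Filter.mem_bot
    obtain ⟨n, J, hJ, hf⟩ := (hF _).1 this
    exact hne n J hJ (by simpa using hf)
  let p := Ultrafilter.of F
  have hp : ∀ s ∈ F, s ∈ p := fun s hs => Ultrafilter.of_le F hs
  have hpinf : ∀ s ∈ p, s.Infinite := by
    intro s hs hfin
    have h1 : sᶜ ∈ p := hp _ ((hF _).2 ⟨0, ∅, Or.inl rfl, hfin.subset fun x hx => by
      simpa using hx.2⟩)
    exact (Ultrafilter.compl_mem_iff_notMem.1 h1) hs
  have hCp : ∀ n, C n ∈ p := fun n => hp _ ((hF _).2 ⟨n, ∅, Or.inl rfl, by simp⟩)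
  obtain ⟨G, hG, hgen⟩ := hbi p fun J hJ =>
    ⟨hinf hJ, hp _ ((hF _).2 ⟨0, J, Or.inr hJ, by
      convert Set.finite_empty
      ext x
      simp⟩)⟩
  obtain ⟨B, hBi, hB⟩ := pseudo_aux (fun n => C n ∩ ⋂ i ∈ Set.Iic n, (G i)ᶜ)
    (fun m n hmn => Set.inter_subset_inter (hCanti hmn)
      (Set.biInter_subset_biInter_left (Set.Iic_subset_Iic.2 hmn)))
    (fun n => hpinf _ (Filter.inter_mem (hCp n)
      ((Filter.biInter_mem (Set.finite_Iic n)).2 fun i _ => (hG i).2)))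
  refine ⟨B, ⟨hBi, fun J hJ => ?_⟩, fun n => (hB n).subset
    (Set.diff_subset_diff_right Set.inter_subset_left)⟩
  obtain ⟨n, hn⟩ := hgen J hJ
  refine ((hB n).union hn).subset ?_
  rintro x ⟨hxB, hxJ⟩
  by_cases hxG : x ∈ G n
  · refine Or.inl ⟨hxB, fun h => ?_⟩
    exact Set.mem_iInter₂.1 h.2 n (Set.mem_Iic.2 le_rfl) hxG
  · exact Or.inr ⟨hxJ, hxG⟩
end

section
/- Let X be a countable infinite set. (i) If 𝒜 ⊆ 𝒫∞(X) is a hereditary family and ℬ is a hereditary subfamily of 𝒜 which is cofinal in 𝒜, then 𝒜 is an M-family if and only if ℬ is an M-family. (ii) If 𝒜, ℬ ⊆ 𝒫∞(X) are two M-families, then 𝒜 ∪ ℬ is an M-family. -/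
open Set

/-- `G` is cofinal in `F` if every member of `F` has an infinite subset in `G`. -/
def Cofinal {X : Type*} (G F : Set (Set X)) : Prop :=
  ∀ A ∈ F, ∃ B ⊆ A, B.Infinite ∧ B ∈ G

theorem MFamily_sub_aux {X : Type*} {F : Set (Set X)} (hF : MFamily F) (A : ℕ → Set X)
    (h : ∃ᶠ n in Filter.atTop, A n ∈ F) :
    ∃ B ∈ F, ∀ n : ℕ, (B \ ⋃ i : ℕ, ⋃ _ : n ≤ i, A i).Finite := by
  obtain ⟨φ, hφ, hA⟩ := Filter.extraction_of_frequently_atTop h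
  obtain ⟨B, hB, hfin⟩ := hF.2 (fun n => A (φ n)) hA
  refine ⟨B, hB, fun n => (hfin n).subset ?_⟩
  refine diff_subset_diff_right ?_
  intro x hx
  simp only [mem_iUnion, exists_prop] at hx ⊢
  obtain ⟨i, hi, hx⟩ := hx
  exact ⟨φ i, hi.trans (hφ.id_le i), hx⟩

theorem stmt9 {X : Type*} [Countable X] [Infinite X] :
    (∀ 𝒜 ℬ : Set (Set X), 𝒜 ⊆ PInf X → Hered 𝒜 → ℬ ⊆ 𝒜 → Hered ℬ →
      Cofinal ℬ 𝒜 → (MFamily 𝒜 ↔ MFamily ℬ)) ∧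
    (∀ 𝒜 ℬ : Set (Set X), 𝒜 ⊆ PInf X → ℬ ⊆ PInf X →
      MFamily 𝒜 → MFamily ℬ → MFamily (𝒜 ∪ ℬ)) := by
  refine ⟨?_, ?_⟩
  · intro 𝒜 ℬ _ hA hBA hB hcof
    constructor
    · intro hM
      refine ⟨hB, fun A hAn => ?_⟩
      obtain ⟨C, hC, hfin⟩ := hM.2 A (fun n => hBA (hAn n))
      obtain ⟨D, hDC, _, hD⟩ := hcof C hC
      exact ⟨D, hD, fun n => (hfin n).subset (diff_subset_diff_left hDC)⟩
    · intro hM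
      refine ⟨hA, fun A hAn => ?_⟩
      choose D hDA _ hD using fun n => hcof (A n) (hAn n)
      obtain ⟨C, hC, hfin⟩ := hM.2 D hD
      exact ⟨C, hBA hC, fun n => (hfin n).subset (diff_subset_diff_right
        (iUnion_mono fun i => iUnion_mono fun _ => hDA i))⟩
  · intro 𝒜 ℬ _ _ hA hB
    refine ⟨?_, fun A hAn => ?_⟩
    · rintro A (h | h) B hBA hinf
      · exact Or.inl (hA.1 A h B hBA hinf)
      · exact Or.inr (hB.1 A h B hBA hinf)
    · have h : ∃ᶠ n in Filter.atTop, (A n ∈ 𝒜 ∨ A n ∈ ℬ) :=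
        (Filter.Eventually.of_forall hAn).frequently
      rcases Filter.frequently_or_distrib.1 h with h | h
      · obtain ⟨C, hC, hf⟩ := MFamily_sub_aux hA A h
        exact ⟨C, Or.inl hC, hf⟩
      · obtain ⟨C, hC, hf⟩ := MFamily_sub_aux hB A h
        exact ⟨C, Or.inr hC, hf⟩
end

section
/- Let 𝒜 ⊆ 𝒫∞(ℕ) be an M-family which is C-measurable (as a subset of the Polish space 𝒫∞(ℕ)), and let 𝐂 = (C_n) be a sequence of members of 𝒜 with C_n ∩ C_m = ∅ for all n ≠ m. Then for every infinite N ⊆ ℕ there exists an infinite L ⊆ N such that Δ_𝐂(M) ∈ 𝒜 for every infinite M ⊆ L. -/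
open Set

/-- Given a sequence `C` of pairwise disjoint infinite subsets of `ℕ` with increasing
enumerations `C n = {x^n_0 < x^n_1 < ...}` and an infinite set `L = {l_0 < l_1 < ...}`,
`DeltaC C L = {x^{l_{2n}}_{l_{2n+1}} : n ∈ ℕ}`. -/
noncomputable def DeltaC (C : ℕ → Set ℕ) (L : Set ℕ) : Set ℕ :=
  Set.range fun n : ℕ =>
    Nat.nth (· ∈ C (Nat.nth (· ∈ L) (2 * n))) (Nat.nth (· ∈ L) (2 * n + 1))

namespace EllRam

/-- Ellentuck neighbourhood. -/
def Nb (s : Finset ℕ) (A : Set ℕ) : Set (Set ℕ) :=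
  {X | X.Infinite ∧ (∀ x ∈ s, x ∈ X) ∧ ∀ x ∈ X, x ∉ s → x ∈ A ∧ ∀ y ∈ s, y < x}

/-- `t` is an end extension of `s` inside `B`. -/
def Ext (s : Finset ℕ) (B : Set ℕ) (t : Finset ℕ) : Prop :=
  s ⊆ t ∧ ∀ x ∈ t, x ∉ s → x ∈ B ∧ ∀ y ∈ s, y < x

lemma Nb_mono {s : Finset ℕ} {A B : Set ℕ} (h : ∀ x ∈ A, (∀ y ∈ s, y < x) → x ∈ B) :
    Nb s A ⊆ Nb s B := by
  rintro X ⟨h1, h2, h3⟩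
  exact ⟨h1, h2, fun x hx hs => ⟨h x (h3 x hx hs).1 (h3 x hx hs).2, (h3 x hx hs).2⟩⟩

lemma tail_inf (s : Finset ℕ) {A : Set ℕ} (hA : A.Infinite) :
    {x ∈ A | ∀ y ∈ s, y < x}.Infinite := by
  have : A \ ↑(Finset.range (s.sup id + 1)) ⊆ {x ∈ A | ∀ y ∈ s, y < x} := by
    rintro x ⟨hx, hx'⟩
    refine ⟨hx, fun y hy => ?_⟩
    have : y ≤ s.sup id := Finset.le_sup (f := id) hy
    simp at hx'
    omega
  exact (hA.sdiff (Finset.finite_toSet _)).mono this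

lemma Nb_nonempty (s : Finset ℕ) {A : Set ℕ} (hA : A.Infinite) : (Nb s A).Nonempty := by
  refine ⟨↑s ∪ {x ∈ A | ∀ y ∈ s, y < x}, (tail_inf s hA).mono subset_union_right, ?_, ?_⟩
  · intro x hx; left; exact hx
  · rintro x (hx | hx) hs
    · exact absurd hx hs
    · exact hx

lemma Nb_union {s t : Finset ℕ} {A X : Set ℕ} (h1 : X ∈ Nb s A) (h2 : X ∈ Nb t X) :
    X ∈ Nb (s ∪ t) X ∧ Nb (s ∪ t) X ⊆ Nb t X ∧ Ext s A (s ∪ t) := by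
  refine ⟨⟨h1.1, ?_, ?_⟩, ?_, ?_, ?_⟩
  · intro x hx
    rcases Finset.mem_union.1 hx with h | h
    · exact h1.2.1 x h
    · exact h2.2.1 x h
  · intro x hx hs
    simp only [Finset.mem_union, not_or] at hs
    refine ⟨hx, fun y hy => ?_⟩
    rcases Finset.mem_union.1 hy with h | h
    · exact (h1.2.2 x hx hs.1).2 y h
    · exact (h2.2.2 x hx hs.2).2 y h
  · rintro Y ⟨hi, ha, hb⟩
    refine ⟨hi, fun x hx => ha x (Finset.mem_union_right _ hx), fun x hx ht => ?_⟩
    by_cases hs : x ∈ s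
    · exact ⟨h1.2.1 x hs, (h2.2.2 x (h1.2.1 x hs) ht).2⟩
    · have := hb x hx (by simp [hs, ht])
      exact ⟨this.1, fun y hy => this.2 y (Finset.mem_union_right _ hy)⟩
  · exact Finset.subset_union_left
  · intro x hx hs
    have : x ∈ t := by
      rcases Finset.mem_union.1 hx with h | h
      · exact absurd h hs
      · exact h
    exact h1.2.2 x (h2.2.1 x this) hs

lemma Nb_ext {s t : Finset ℕ} {B X : Set ℕ} (h1 : X ∈ Nb s B) (h2 : X ∈ Nb t X) (h : s ⊆ t) :
    X ∈ Nb t B := by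
  refine ⟨h1.1, h2.2.1, fun x hx ht => ?_⟩
  exact ⟨(h1.2.2 x hx (fun hs => ht (h hs))).1, (h2.2.2 x hx ht).2⟩

lemma dense_fin (D : Finset ℕ → Set ℕ → Prop)
    (tail : ∀ t A A', (∀ x ∈ A', (∀ y ∈ t, y < x) → x ∈ A) → D t A → D t A')
    (dense : ∀ t A, A.Infinite → ∃ A' ⊆ A, A'.Infinite ∧ D t A')
    (T : Finset (Finset ℕ)) (A : Set ℕ) (hA : A.Infinite) :
    ∃ A' ⊆ A, A'.Infinite ∧ ∀ t ∈ T, D t A' := by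
  classical
  induction T using Finset.induction_on with
  | empty => exact ⟨A, subset_rfl, hA, by simp⟩
  | insert t T _ ih =>
    obtain ⟨A1, h1, h2, h3⟩ := ih
    obtain ⟨A2, h4, h5, h6⟩ := dense t A1 h2
    refine ⟨A2, h4.trans h1, h5, fun u hu => ?_⟩
    rcases Finset.mem_insert.1 hu with rfl | hu
    · exact h6
    · exact tail u A1 A2 (fun x hx _ => h4 hx) (h3 u hu)

lemma fusion (D : Finset ℕ → Set ℕ → Prop)
    (tail : ∀ t A A', (∀ x ∈ A', (∀ y ∈ t, y < x) → x ∈ A) → D t A → D t A')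
    (dense : ∀ t A, A.Infinite → ∃ A' ⊆ A, A'.Infinite ∧ D t A')
    (s : Finset ℕ) (A : Set ℕ) (hA : A.Infinite) :
    ∃ B ⊆ A, B.Infinite ∧ ∀ t, Ext s B t → D t B := by
  classical
  have step : ∀ A : {A : Set ℕ // A.Infinite}, ∃ A' : {A : Set ℕ // A.Infinite},
      (A' : Set ℕ) ⊆ A ∧ (∀ x ∈ (A' : Set ℕ), sInf (A : Set ℕ) < x) ∧
      ∀ t ⊆ Finset.range (sInf (A : Set ℕ) + 1), D t A' := by
    rintro ⟨A, hA⟩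
    obtain ⟨A', h1, h2, h3⟩ := dense_fin D tail dense
      (Finset.range (sInf A + 1)).powerset _ (tail_inf {sInf A} hA)
    refine ⟨⟨A', h2⟩, fun x hx => (h1 hx).1, fun x hx => ?_, fun t ht => h3 t (by simpa using ht)⟩
    exact (h1 hx).2 _ (by simp)
  choose nx hn1 hn2 hn3 using step
  obtain ⟨A0, h01, h02, h03⟩ := dense s A hA
  let S : ℕ → {A : Set ℕ // A.Infinite} := fun n => nx^[n] ⟨A0, h02⟩
  have hS : ∀ n, S (n + 1) = nx (S n) := fun n => Function.iterate_succ_apply' _ _ _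
  have hanti : Antitone fun n => (S n : Set ℕ) := by
    apply antitone_nat_of_succ_le
    intro n
    show (S (n + 1) : Set ℕ) ⊆ S n
    rw [hS]; exact hn1 _
  let b : ℕ → ℕ := fun n => sInf (S n : Set ℕ)
  have hb : ∀ n, b n ∈ (S n : Set ℕ) := fun n => Nat.sInf_mem (S n).2.nonempty
  have hbm : StrictMono b := by
    apply strictMono_nat_of_lt_succ
    intro n
    have := hb (n + 1)
    rw [hS] at this
    exact hn2 _ _ this
  have hB0 : Set.range b ⊆ A0 := by
    rintro _ ⟨n, rfl⟩
    exact hanti (Nat.zero_le n) (hb n)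
  refine ⟨Set.range b, hB0.trans h01, Set.infinite_range_of_injective hbm.injective, ?_⟩
  rintro t ⟨hst, ht⟩
  by_cases hne : (t \ s).Nonempty
  · have hm := Finset.max'_mem _ hne
    rw [Finset.mem_sdiff] at hm
    obtain ⟨⟨n, hnb⟩, hlt⟩ := ht _ hm.1 hm.2
    have hsub : t ⊆ Finset.range (b n + 1) := by
      intro x hx
      rw [Finset.mem_range, hnb]
      by_cases hxs : x ∈ s
      · have := hlt x hxs; omega
      · have := Finset.le_max' (t \ s) x (Finset.mem_sdiff.2 ⟨hx, hxs⟩); omega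
    have hD := hn3 (S n) t hsub
    rw [← hS] at hD
    refine tail t _ _ ?_ hD
    rintro _ ⟨m, rfl⟩ hx
    have h1 := hx _ hm.1
    rw [← hnb] at h1
    exact hanti (Nat.succ_le_of_lt (hbm.lt_iff_lt.1 h1)) (hb m)
  · have : t = s := by
      rw [Finset.not_nonempty_iff_eq_empty, Finset.sdiff_eq_empty_iff_subset] at hne
      exact Finset.Subset.antisymm hne hst
    subst this
    exact tail t _ _ (fun x hx _ => hB0 hx) h03

def Null (Q : Set (Set ℕ)) : Prop :=
  ∀ s A, A.Infinite → ∃ B ⊆ A, B.Infinite ∧ ∀ X ∈ Nb s B, X ∉ Q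

def CR (Q : Set (Set ℕ)) : Prop :=
  ∀ s A, A.Infinite → ∃ B ⊆ A, B.Infinite ∧ ((∀ X ∈ Nb s B, X ∈ Q) ∨ ∀ X ∈ Nb s B, X ∉ Q)

def EOpen (U : Set (Set ℕ)) : Prop :=
  ∀ X ∈ U, X.Infinite → ∃ t, X ∈ Nb t X ∧ Nb t X ⊆ U

lemma Null.mono {P Q : Set (Set ℕ)} (h : Null Q) (hPQ : P ⊆ Q) : Null P := by
  intro s A hA
  obtain ⟨B, h1, h2, h3⟩ := h s A hA
  exact ⟨B, h1, h2, fun X hX hP => h3 X hX (hPQ hP)⟩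

lemma Null.cr {Q : Set (Set ℕ)} (h : Null Q) : CR Q := by
  intro s A hA
  obtain ⟨B, h1, h2, h3⟩ := h s A hA
  exact ⟨B, h1, h2, Or.inr h3⟩

lemma CR.compl {Q : Set (Set ℕ)} (h : CR Q) : CR Qᶜ := by
  intro s A hA
  obtain ⟨B, h1, h2, h3⟩ := h s A hA
  exact ⟨B, h1, h2, h3.symm.imp (fun h X hX => h X hX) (fun h X hX hn => hn (h X hX))⟩

lemma init_mem {X : Set ℕ} (hX : X.Infinite) (n : ℕ) :
    ∃ t : Finset ℕ, X ∈ Nb t X ∧ ∀ x, x ∈ t ↔ x ∈ X ∧ x ≤ n := by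
  classical
  refine ⟨(Finset.range (n + 1)).filter (· ∈ X), ⟨hX, by simp, ?_⟩, ?_⟩
  · intro x hx hxt
    refine ⟨hx, fun y hy => ?_⟩
    simp [hx] at hxt hy
    omega
  · intro x
    simp only [Finset.mem_filter, Finset.mem_range]
    constructor
    · rintro ⟨h1, h2⟩; exact ⟨h2, by omega⟩
    · rintro ⟨h1, h2⟩; exact ⟨by omega, h1⟩

lemma Null.iUnion {Q : ℕ → Set (Set ℕ)} (h : ∀ n, Null (Q n)) : Null (⋃ n, Q n) := by
  intro s A hA
  have key : ∀ (t : Finset ℕ) (k : ℕ) (A : Set ℕ), A.Infinite → ∃ A' ⊆ A, A'.Infinite ∧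
      ∀ n < k, ∀ X ∈ Nb t A', X ∉ Q n := by
    intro t k
    induction k with
    | zero => intro A hA; exact ⟨A, subset_rfl, hA, by simp⟩
    | succ k ih =>
      intro A hA
      obtain ⟨A1, h1, h2, h3⟩ := ih A hA
      obtain ⟨A2, h4, h5, h6⟩ := h k t A1 h2
      refine ⟨A2, h4.trans h1, h5, fun n hn X hX => ?_⟩
      rcases Nat.lt_succ_iff_lt_or_eq.1 hn with hn | rfl
      · exact h3 n hn X (Nb_mono (fun x hx _ => h4 hx) hX)
      · exact h6 X hX
  obtain ⟨B, h1, h2, h3⟩ := fusion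
    (fun t A => ∀ n < t.sup id + 1, ∀ X ∈ Nb t A, X ∉ Q n)
    (fun t A A' hAA h n hn X hX => h n hn X (Nb_mono hAA hX))
    (fun t A hA => key t _ A hA) s A hA
  refine ⟨B, h1, h2, fun X hX hQ => ?_⟩
  obtain ⟨n, hn⟩ := mem_iUnion.1 hQ
  obtain ⟨m, hm, hnm⟩ := hX.1.exists_gt n
  obtain ⟨t, ht, htm⟩ := init_mem hX.1 m
  obtain ⟨a1, a2, a3⟩ := Nb_union hX ht
  refine h3 _ a3 n ?_ X (Nb_ext hX a1 Finset.subset_union_left) hn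
  have : m ≤ (s ∪ t).sup id :=
    Finset.le_sup (f := id) (Finset.mem_union_right _ ((htm m).2 ⟨hm, le_rfl⟩))
  omega

lemma EOpen.cr {U : Set (Set ℕ)} (hU : EOpen U) : CR U := by
  classical
  intro s A hA
  obtain ⟨B, hBA, hB, hBD⟩ := fusion
    (fun t A => (Nb t A ⊆ U) ∨ ∀ A', (∀ x ∈ A', (∀ y ∈ t, y < x) → x ∈ A) → A'.Infinite → ¬ Nb t A' ⊆ U)
    (fun t A A' hAA h => h.imp (fun h => (Nb_mono hAA).trans h)
      (fun h A'' h1 h2 => h A'' (fun x hx hy => hAA x (h1 x hx hy) hy) h2))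
    (fun t A hA => by
      by_cases h : ∃ A', (∀ x ∈ A', (∀ y ∈ t, y < x) → x ∈ A) ∧ A'.Infinite ∧ Nb t A' ⊆ U
      · obtain ⟨A', h1, h2, h3⟩ := h
        exact ⟨_, fun x hx => h1 x hx.1 hx.2, tail_inf t h2,
          Or.inl ((Nb_mono (fun x hx _ => hx.1)).trans h3)⟩
      · push Not at h
        exact ⟨A, subset_rfl, hA, Or.inr h⟩) s A hA
  obtain ⟨B', hB'B, hB', hBD'⟩ := fusion
    (fun t A => Ext s B t → Nb t B ⊆ U ∨
      ∀ n ∈ A, n ∈ B → (∀ y ∈ t, y < n) → ¬ Nb (insert n t) B ⊆ U)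
    (fun t A A' hAA h he => (h he).imp id fun h n hn hnB hy => h n (hAA n hn hy) hnB hy)
    (fun t A hA => by
      by_cases he : Ext s B t
      swap
      · exact ⟨A, subset_rfl, hA, fun h => absurd h he⟩
      rcases hBD t he with h | h
      · exact ⟨A, subset_rfl, hA, fun _ => Or.inl h⟩
      let S : Set ℕ := {n | n ∈ B ∧ (∀ y ∈ t, y < n) ∧ Nb (insert n t) B ⊆ U}
      have hS : S.Finite := by
        by_contra hS
        refine h S (fun x hx _ => hx.1) hS ?_
        intro X hX
        have hne : (X \ ↑t).Nonempty := (hX.1.sdiff t.finite_toSet).nonempty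
        have hm := Nat.sInf_mem hne
        set n := sInf (X \ ↑t) with hn
        have hnS := (hX.2.2 n hm.1 hm.2).1
        refine hnS.2.2 ⟨hX.1, ?_, ?_⟩
        · intro x hx
          rcases Finset.mem_insert.1 hx with rfl | hx
          · exact hm.1
          · exact hX.2.1 x hx
        · intro x hx hxt
          rw [Finset.mem_insert, not_or] at hxt
          have h1 := hX.2.2 x hx hxt.2
          refine ⟨h1.1.1, fun y hy => ?_⟩
          rcases Finset.mem_insert.1 hy with rfl | hy
          · exact lt_of_le_of_ne (Nat.sInf_le ⟨hx, hxt.2⟩) (Ne.symm hxt.1)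
          · exact h1.2 y hy
      exact ⟨A \ S, fun x hx => hx.1, hA.sdiff hS,
        fun _ => Or.inr fun n hn hnB hy hU => hn.2 ⟨hnB, hy, hU⟩⟩) s B hB
  by_cases hs : Nb s B ⊆ U
  · exact ⟨B', hB'B.trans hBA, hB', Or.inl fun X hX => hs (Nb_mono (fun x hx _ => hB'B hx) hX)⟩
  have hrej : ∀ k : ℕ, ∀ t, (t \ s).card = k → Ext s B' t → ¬ Nb t B ⊆ U := by
    intro k
    induction k with
    | zero =>
      intro t hk ht
      rw [Finset.card_eq_zero, Finset.sdiff_eq_empty_iff_subset] at hk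
      rwa [Finset.Subset.antisymm hk ht.1]
    | succ k ih =>
      intro t hk ht
      have hne : (t \ s).Nonempty := by rw [← Finset.card_pos]; omega
      have hm := Finset.max'_mem _ hne
      set n := (t \ s).max' hne with hn
      have hm' := Finset.mem_sdiff.1 hm
      have he : Ext s B' (t.erase n) := by
        refine ⟨fun x hx => Finset.mem_erase.2 ⟨?_, ht.1 hx⟩, fun x hx => ht.2 x (Finset.mem_of_mem_erase hx)⟩
        rintro rfl; exact hm'.2 hx
      have hnB := ht.2 n hm'.1 hm'.2
      have hc : (t.erase n \ s).card = k := by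
        rw [Finset.erase_sdiff_comm, Finset.card_erase_of_mem hm]; omega
      have h1 := ih _ hc he
      have h2 := (hBD' _ he ⟨he.1, fun x hx hxs => ⟨hB'B (he.2 x hx hxs).1, (he.2 x hx hxs).2⟩⟩).resolve_left h1
        n hnB.1 (hB'B hnB.1) ?_
      · rwa [Finset.insert_erase hm'.1] at h2
      · intro y hy
        rw [Finset.mem_erase] at hy
        by_cases hys : y ∈ s
        · exact hnB.2 y hys
        · exact lt_of_le_of_ne (Finset.le_max' _ _ (Finset.mem_sdiff.2 ⟨hy.2, hys⟩)) hy.1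
  refine ⟨B', hB'B.trans hBA, hB', Or.inr fun X hX hXU => ?_⟩
  obtain ⟨t, h1, h2⟩ := hU X hXU hX.1
  obtain ⟨a1, a2, a3⟩ := Nb_union hX h1
  have a4 : Ext s B (s ∪ t) := ⟨a3.1, fun x hx hxs => ⟨hB'B (a3.2 x hx hxs).1, (a3.2 x hx hxs).2⟩⟩
  refine (hBD _ a4).elim (hrej _ _ rfl a3) fun h => h X ?_ hX.1 (a2.trans h2)
  intro x hx hy
  refine hB'B (hX.2.2 x hx fun hxs => ?_).1
  exact lt_irrefl _ (hy x (Finset.mem_union_left _ hxs))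

def EInt (Q : Set (Set ℕ)) : Set (Set ℕ) := {X | ∃ t, X ∈ Nb t X ∧ Nb t X ⊆ Q}

lemma Nb_self_mono {t : Finset ℕ} {X Y : Set ℕ} (hY : Y ∈ Nb t X) : Y ∈ Nb t Y :=
  ⟨hY.1, hY.2.1, fun x hx ht => ⟨hx, (hY.2.2 x hx ht).2⟩⟩

lemma Nb_trans {t : Finset ℕ} {X Y : Set ℕ} (hY : Y ∈ Nb t X) : Nb t Y ⊆ Nb t X := by
  intro Z hZ
  refine ⟨hZ.1, hZ.2.1, fun x hx ht => ⟨?_, (hZ.2.2 x hx ht).2⟩⟩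
  exact (hY.2.2 x (hZ.2.2 x hx ht).1 ht).1

lemma mem_EInt {Q : Set (Set ℕ)} {t : Finset ℕ} {A X : Set ℕ} (hX : X ∈ Nb t A)
    (h : Nb t A ⊆ Q) : X ∈ EInt Q :=
  ⟨t, Nb_self_mono hX, (Nb_trans hX).trans h⟩

lemma EInt_open (Q : Set (Set ℕ)) : EOpen (EInt Q) := by
  rintro X ⟨t, h1, h2⟩ _
  exact ⟨t, h1, fun Y hY => mem_EInt hY h2⟩

lemma CR.null {Q : Set (Set ℕ)} (h : CR Q) : Null (Q \ EInt Q) := by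
  intro s A hA
  obtain ⟨B, h1, h2, h3 | h3⟩ := h s A hA
  · exact ⟨B, h1, h2, fun X hX hq => hq.2 (mem_EInt hX h3)⟩
  · exact ⟨B, h1, h2, fun X hX hq => h3 X hX hq.1⟩

lemma cr_of_null {Q P : Set (Set ℕ)} (hP : CR P) (hPQ : P ⊆ Q) (h : Null (Q \ P)) : CR Q := by
  intro s A hA
  obtain ⟨B, h1, h2, h3 | h3⟩ := hP s A hA
  · exact ⟨B, h1, h2, Or.inl fun X hX => hPQ (h3 X hX)⟩
  · obtain ⟨B', h4, h5, h6⟩ := h s B h2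
    refine ⟨B', h4.trans h1, h5, Or.inr fun X hX hq => h6 X hX ⟨hq, ?_⟩⟩
    exact h3 X (Nb_mono (fun x hx _ => h4 hx) hX)

lemma CR.iUnion {Q : ℕ → Set (Set ℕ)} (h : ∀ n, CR (Q n)) : CR (⋃ n, Q n) := by
  refine cr_of_null (EInt_open (⋃ n, Q n)).cr ?_ ((Null.iUnion fun n => (h n).null).mono ?_)
  · rintro X ⟨t, h1, h2⟩; exact h2 h1
  · rintro X ⟨h1, h2⟩
    obtain ⟨n, hn⟩ := mem_iUnion.1 h1
    refine mem_iUnion.2 ⟨n, hn, ?_⟩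
    rintro ⟨t, h3, h4⟩
    exact h2 ⟨t, h3, h4.trans (subset_iUnion _ n)⟩

lemma CR.inter {P Q : Set (Set ℕ)} (hP : CR P) (hQ : CR Q) : CR (P ∩ Q) := by
  intro s A hA
  obtain ⟨B, h1, h2, h3 | h3⟩ := hP s A hA
  · obtain ⟨B', h4, h5, h6⟩ := hQ s B h2
    refine ⟨B', h4.trans h1, h5, h6.imp (fun h X hX => ⟨?_, h X hX⟩) fun h X hX hq => h X hX hq.2⟩
    exact h3 X (Nb_mono (fun x hx _ => h4 hx) hX)
  · exact ⟨B, h1, h2, Or.inr fun X hX hq => h3 X hX hq.1⟩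

/-- the part of the Souslin set through the node `l`. -/
def Part (P : List ℕ → Set (Set ℕ)) (l : List ℕ) : Set (Set ℕ) :=
  {X | ∃ σ : ℕ → ℕ, (List.ofFn fun i : Fin l.length => σ i) = l ∧
    ∀ n, X ∈ P (List.ofFn fun i : Fin n => σ i)}

lemma CR.souslin {P : List ℕ → Set (Set ℕ)} (h : ∀ l, CR (P l)) :
    CR (⋃ σ : ℕ → ℕ, ⋂ n : ℕ, P (List.ofFn fun i : Fin n => σ i)) := by
  let E : List ℕ → Set (Set ℕ) := fun l => (EInt (Part P l)ᶜ)ᶜ ∩ P l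
  have hE : ∀ l, CR (E l) := fun l => (EInt_open _).cr.compl.inter (h l)
  have hPE : ∀ l, Part P l ⊆ E l := by
    rintro l X ⟨σ, h1, h2⟩
    refine ⟨?_, ?_⟩
    · rintro ⟨t, h3, h4⟩
      exact h4 h3 ⟨σ, h1, h2⟩
    · have := h2 l.length
      rwa [h1] at this
  have hPs : ∀ l, Part P l ⊆ ⋃ n, Part P (l ++ [n]) := by
    rintro l X ⟨σ, h1, h2⟩
    refine mem_iUnion.2 ⟨σ l.length, σ, ?_, h2⟩
    have : (l ++ [σ l.length]).length = l.length + 1 := by simp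
    rw [this, List.ofFn_succ_last]
    simp [h1]
  have hN : ∀ l, Null (E l \ ⋃ n, E (l ++ [n])) := by
    intro l s A hA
    have hc : CR (E l \ ⋃ n, E (l ++ [n])) :=
      (hE l).inter (CR.iUnion fun n => hE _).compl
    obtain ⟨B, h1, h2, h3 | h3⟩ := hc s A hA
    · exfalso
      obtain ⟨X, hX⟩ := Nb_nonempty s h2
      refine (h3 X hX).1.1 (mem_EInt hX ?_)
      intro Y hY hYP
      obtain ⟨n, hn⟩ := mem_iUnion.1 (hPs l hYP)
      exact (h3 Y hY).2 (mem_iUnion.2 ⟨n, hPE _ hn⟩)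
    · exact ⟨B, h1, h2, h3⟩
  have hNN : Null (⋃ k : ℕ, ((Encodable.decode k : Option (List ℕ)).elim ∅
      fun l => E l \ ⋃ n, E (l ++ [n]))) := by
    apply Null.iUnion
    intro k
    cases h : (Encodable.decode k : Option (List ℕ)) with
    | none => exact fun s A hA => ⟨A, subset_rfl, hA, by simp⟩
    | some l => exact hN l
  set W := (⋃ k : ℕ, ((Encodable.decode k : Option (List ℕ)).elim ∅
      fun l => E l \ ⋃ n, E (l ++ [n]))) with hW
  have hsub : E [] \ W ⊆ ⋃ σ : ℕ → ℕ, ⋂ n : ℕ, P (List.ofFn fun i : Fin n => σ i) := by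
    rintro X ⟨hX, hXW⟩
    have st : ∀ l : {l // X ∈ E l}, ∃ n, X ∈ E (l.1 ++ [n]) := by
      rintro ⟨l, hl⟩
      by_contra hcon
      apply hXW
      refine mem_iUnion.2 ⟨Encodable.encode l, ?_⟩
      simp only [Encodable.encodek, Option.elim]
      exact ⟨hl, fun hh => hcon (mem_iUnion.1 hh)⟩
    choose f hf using st
    let S : ℕ → {l // X ∈ E l} := fun n => (fun l => ⟨l.1 ++ [f l], hf l⟩)^[n] ⟨[], hX⟩
    have hS : ∀ n, (S (n + 1)).1 = (S n).1 ++ [f (S n)] := fun n => by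
      simp only [S, Function.iterate_succ_apply']
    refine mem_iUnion.2 ⟨fun n => f (S n), mem_iInter.2 fun n => ?_⟩
    have : (List.ofFn fun i : Fin n => f (S i)) = (S n).1 := by
      induction n with
      | zero => simp [S]
      | succ n ih => rw [List.ofFn_succ_last, hS]; simp [ih]
    rw [this]
    exact (S n).2.2
  refine cr_of_null ((hE []).inter hNN.cr.compl) hsub (hNN.mono ?_)
  rintro X ⟨h1, h2⟩
  by_contra h3
  refine h2 ⟨hPE _ ?_, h3⟩
  obtain ⟨σ, hσ⟩ := mem_iUnion.1 h1
  exact ⟨σ, by simp, fun n => mem_iInter.1 hσ n⟩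


lemma nth_agree {X Y : Set ℕ} {t : Finset ℕ} (hX : X.Infinite) {m : ℕ}
    (ht : ∀ x, x ∈ t ↔ x ∈ X ∧ x ≤ m) (hY : Y ∈ Nb t X) {i : ℕ}
    (hi : Nat.nth (· ∈ X) i ≤ m) : Nat.nth (· ∈ Y) i = Nat.nth (· ∈ X) i := by
  classical
  set a := Nat.nth (· ∈ X) i with ha
  have haX : a ∈ X := Nat.nth_mem_of_infinite (p := (· ∈ X)) hX i
  have hYX : ∀ x ≤ m, (x ∈ Y ↔ x ∈ X) := by
    intro x hx
    constructor
    · intro h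
      by_cases hxt : x ∈ t
      · exact ((ht x).1 hxt).1
      · exact (hY.2.2 x h hxt).1
    · intro h; exact hY.2.1 x ((ht x).2 ⟨h, hx⟩)
  have hc : Nat.count (· ∈ Y) a = i := by
    rw [← Nat.count_nth_of_infinite (p := (· ∈ X)) hX i, ← ha, Nat.count_eq_card_filter_range,
      Nat.count_eq_card_filter_range]
    congr 1
    apply Finset.filter_congr
    intro x hx
    rw [Finset.mem_range] at hx
    exact hYX x (by omega)
  rw [← hc]
  exact Nat.nth_count (p := (· ∈ Y)) ((hYX a hi).2 haX)

lemma le_nth {X : Set ℕ} (hX : X.Infinite) (i : ℕ) : i ≤ Nat.nth (· ∈ X) i :=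
  (Nat.nth_strictMono (p := (· ∈ X)) hX).le_apply

lemma delta_open {C : ℕ → Set ℕ} (hC : ∀ n, (C n).Infinite) {S : Set (ℕ → Bool)}
    (hS : IsOpen S) : EOpen {X | chi (DeltaC C X) ∈ S} := by
  intro X hX hXi
  obtain ⟨I, u, h1, h2⟩ := isOpen_pi_iff.1 hS _ hX
  obtain ⟨t, h3, h4⟩ := init_mem hXi (Nat.nth (· ∈ X) (2 * I.sup id + 1))
  refine ⟨t, h3, fun Y hY => h2 ?_⟩
  have hmono := (Nat.nth_strictMono (p := (· ∈ X)) hXi).monotone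
  have ag : ∀ i ≤ 2 * I.sup id + 1, Nat.nth (· ∈ Y) i = Nat.nth (· ∈ X) i :=
    fun i hi => nth_agree hXi h4 hY (hmono hi)
  have bd : ∀ Z : Set ℕ, Z.Infinite → ∀ n x, x ∈ I →
      Nat.nth (· ∈ C (Nat.nth (· ∈ Z) (2 * n))) (Nat.nth (· ∈ Z) (2 * n + 1)) = x →
      n ≤ I.sup id := by
    intro Z hZ n x hx h
    have a := le_nth (hC (Nat.nth (· ∈ Z) (2 * n))) (Nat.nth (· ∈ Z) (2 * n + 1))
    have b := le_nth hZ (2 * n + 1)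
    have c : x ≤ I.sup id := Finset.le_sup (f := id) hx
    omega
  intro x hx
  have : chi (DeltaC C Y) x = chi (DeltaC C X) x := by
    have : x ∈ DeltaC C Y ↔ x ∈ DeltaC C X := by
      constructor
      · rintro ⟨n, hn⟩
        have := bd Y hY.1 n x hx hn
        refine ⟨n, ?_⟩
        simp only at hn ⊢
        rwa [ag (2 * n) (by omega), ag (2 * n + 1) (by omega)] at hn
      · rintro ⟨n, hn⟩
        have := bd X hXi n x hx hn
        refine ⟨n, ?_⟩
        simp only at hn ⊢
        rwa [ag (2 * n) (by omega), ag (2 * n + 1) (by omega)]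
    simp [chi, this]
  rw [this]
  exact (h1 x hx).2

lemma delta_cr {C : ℕ → Set ℕ} (hC : ∀ n, (C n).Infinite) {S : Set (ℕ → Bool)}
    (hS : CMeas S) : CR {X | chi (DeltaC C X) ∈ S} := by
  induction hS with
  | isOpen s hs => exact (delta_open hC hs).cr
  | compl s _ ih => exact ih.compl
  | iUnion f _ ih =>
    have := CR.iUnion ih
    convert this using 1
    ext X; simp
  | souslin P _ ih =>
    have := CR.souslin ih
    convert this using 1
    ext X; simp

lemma chi_inj {X : Type*} {A B : Set X} (h : chi A = chi B) : A = B := by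
  ext x
  have := congrFun h x
  simpa [chi] using this

lemma nth_range {f : ℕ → ℕ} (hf : StrictMono f) (i : ℕ) : Nat.nth (· ∈ Set.range f) i = f i := by
  have hi : (Set.range f).Infinite := Set.infinite_range_of_injective hf.injective
  have := (StrictMono.range_inj (Nat.nth_strictMono (p := (· ∈ Set.range f)) hi) hf).1
    (Nat.range_nth_of_infinite (p := (· ∈ Set.range f)) hi)
  exact congrFun this i

lemma exists_good {𝒜 : Set (Set ℕ)} (h𝒜P : 𝒜 ⊆ PInf ℕ)
    (h𝒜M : MFamily 𝒜) {C : ℕ → Set ℕ} (hC : ∀ n, C n ∈ 𝒜) {L : Set ℕ} (hL : L.Infinite) :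
    ∃ M ⊆ L, M.Infinite ∧ DeltaC C M ∈ 𝒜 := by
  have hCi : ∀ n, (C n).Infinite := fun n => h𝒜P (hC n)
  let A : ℕ → Set ℕ := fun i =>
    (fun k => Nat.nth (· ∈ C (Nat.nth (· ∈ L) i)) k) '' {k ∈ L | ∀ y ∈ ({Nat.nth (· ∈ L) i} : Finset ℕ), y < k}
  have hA : ∀ i, A i ∈ 𝒜 := by
    intro i
    refine h𝒜M.1 _ (hC (Nat.nth (· ∈ L) i)) _ ?_ ?_
    · rintro _ ⟨k, _, rfl⟩
      exact Nat.nth_mem_of_infinite (p := (· ∈ C (Nat.nth (· ∈ L) i))) (hCi _) k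
    · exact (tail_inf _ hL).image
        (Nat.nth_strictMono (p := (· ∈ C (Nat.nth (· ∈ L) i))) (hCi _)).injective.injOn
  obtain ⟨B, hB, hBf⟩ := h𝒜M.2 A hA
  have key : ∀ m, ∃ p : ℕ × ℕ, p.1 ∈ L ∧ p.2 ∈ L ∧ m < p.1 ∧ p.1 < p.2 ∧
      Nat.nth (· ∈ C p.1) p.2 ∈ B := by
    intro m
    obtain ⟨b, hb, hb'⟩ := ((h𝒜P hB : B.Infinite).sdiff (hBf (m + 1))).nonempty
    have : b ∈ ⋃ i : ℕ, ⋃ _ : m + 1 ≤ i, A i := by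
      by_contra h; exact hb' ⟨hb, h⟩
    simp only [mem_iUnion] at this
    obtain ⟨i, hi, k, hk, rfl⟩ := this
    refine ⟨(Nat.nth (· ∈ L) i, k), Nat.nth_mem_of_infinite (p := (· ∈ L)) hL i, hk.1, ?_,
      hk.2 _ (by simp), hb⟩
    have := le_nth hL i
    show m < Nat.nth (· ∈ L) i
    omega
  choose g g1 g2 g3 g4 g5 using key
  let p : ℕ → ℕ := fun n => (fun m => (g m).2)^[n] 0
  have hp : ∀ n, p (n + 1) = (g (p n)).2 := fun n => Function.iterate_succ_apply' _ _ _
  let f : ℕ → ℕ := fun i => if i % 2 = 0 then (g (p (i / 2))).1 else (g (p (i / 2))).2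
  have f0 : ∀ n, f (2 * n) = (g (p n)).1 := fun n => by simp [f]
  have f1 : ∀ n, f (2 * n + 1) = (g (p n)).2 := fun n => by
    have : (2 * n + 1) / 2 = n := by omega
    simp [f, this, Nat.add_mod]
  have hf : StrictMono f := by
    apply strictMono_nat_of_lt_succ
    intro i
    obtain ⟨n, rfl | rfl⟩ := Nat.even_or_odd' i
    · rw [f0, f1]; exact g4 _
    · rw [f1, show 2 * n + 1 + 1 = 2 * (n + 1) by ring, f0, ← hp]; exact g3 _
  have hD : ∀ n, Nat.nth (· ∈ C (Nat.nth (· ∈ Set.range f) (2 * n)))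
      (Nat.nth (· ∈ Set.range f) (2 * n + 1)) = Nat.nth (· ∈ C (g (p n)).1) (g (p n)).2 := by
    intro n
    rw [nth_range hf, nth_range hf, f0, f1]
  refine ⟨Set.range f, ?_, Set.infinite_range_of_injective hf.injective, h𝒜M.1 B hB _ ?_ ?_⟩
  · rintro _ ⟨i, rfl⟩
    obtain ⟨n, rfl | rfl⟩ := Nat.even_or_odd' i
    · rw [f0]; exact g1 _
    · rw [f1]; exact g2 _
  · rintro _ ⟨n, rfl⟩
    simp only [hD]
    exact g5 _
  · rw [Set.infinite_iff_exists_gt]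
    intro a
    refine ⟨_, ⟨a, rfl⟩, ?_⟩
    have h1 := le_nth (hCi (Nat.nth (· ∈ Set.range f) (2 * a))) (Nat.nth (· ∈ Set.range f) (2 * a + 1))
    have h2 := nth_range hf (2 * a + 1)
    have h3 : 2 * a + 1 ≤ f (2 * a + 1) := hf.le_apply
    simp only
    omega

end EllRam

theorem stmt10 (𝒜 : Set (Set ℕ)) (h𝒜P : 𝒜 ⊆ PInf ℕ)
    (h𝒜M : MFamily 𝒜) (h𝒜C : CMeasFam 𝒜)
    (C : ℕ → Set ℕ) (hC : ∀ n, C n ∈ 𝒜)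
    (hdisj : ∀ n m : ℕ, n ≠ m → C n ∩ C m = ∅)
    (N : Set ℕ) (hN : N.Infinite) :
    ∃ L ⊆ N, L.Infinite ∧ ∀ M ⊆ L, M.Infinite → DeltaC C M ∈ 𝒜 := by
  have hCi : ∀ n, (C n).Infinite := fun n => h𝒜P (hC n)
  have hmem : ∀ M : Set ℕ, M.Infinite → ∀ L, M ⊆ L → M ∈ EllRam.Nb ∅ L := fun M hM L hML =>
    ⟨hM, by simp, fun x hx _ => ⟨hML hx, by simp⟩⟩
  obtain ⟨L, h1, h2, h3 | h3⟩ := EllRam.delta_cr hCi h𝒜C ∅ N hN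
  · refine ⟨L, h1, h2, fun M hM hMi => ?_⟩
    obtain ⟨A, hA, hAe⟩ := h3 M (hmem M hMi L hM)
    rwa [← EllRam.chi_inj hAe]
  · obtain ⟨M, hM, hMi, hD⟩ := EllRam.exists_good h𝒜P h𝒜M hC h2
    exact absurd ⟨_, hD, rfl⟩ (h3 M (hmem M hMi L hM))
end

section
/- Let X be a countable infinite set and 𝒜, ℬ ⊆ 𝒫∞(X) be two M-families. If 𝒜 and ℬ are C-measurable (as subsets of the Polish space 𝒫∞(X)), then 𝒜 ∩ ℬ is an M-family. -/
open Set

namespace Ell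

/-- Basic Ellentuck set. -/
def bas (s : Finset ℕ) (A : Set ℕ) : Set (Set ℕ) :=
  {x | x.Infinite ∧ (∀ k ∈ s, k ∈ x) ∧ ∀ n ∈ x, n ∉ s → n ∈ A ∧ ∀ k ∈ s, k < n}

open Classical in
/-- Initial part. -/
noncomputable def ini (x : Set ℕ) (m : ℕ) : Finset ℕ := (Finset.range m).filter (· ∈ x)

lemma mem_ini {x : Set ℕ} {m n : ℕ} : n ∈ ini x m ↔ n < m ∧ n ∈ x := by
  simp [ini]

/-- Part of `A` above `t`. -/
def above (t : Finset ℕ) (A : Set ℕ) : Set ℕ := {n ∈ A | ∀ k ∈ t, k < n}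

lemma above_sub (t : Finset ℕ) (A : Set ℕ) : above t A ⊆ A := fun _ h => h.1

lemma bas_mono {s : Finset ℕ} {A B : Set ℕ} (h : A ⊆ B) : bas s A ⊆ bas s B :=
  fun _ hx => ⟨hx.1, hx.2.1, fun n hn hs => ⟨h (hx.2.2 n hn hs).1, (hx.2.2 n hn hs).2⟩⟩

lemma bas_above {s t : Finset ℕ} {A : Set ℕ} (hts : t ⊆ s) : bas s A ⊆ bas s (above t A) :=
  fun _ hx => ⟨hx.1, hx.2.1, fun n hn hs =>
    ⟨⟨(hx.2.2 n hn hs).1, fun k hk => (hx.2.2 n hn hs).2 k (hts hk)⟩, (hx.2.2 n hn hs).2⟩⟩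

lemma inf_gt {A : Set ℕ} (hA : A.Infinite) (N : ℕ) : {n ∈ A | N < n}.Infinite := by
  intro h
  apply hA
  apply (h.union (Set.finite_Iic N)).subset
  intro n hn
  by_cases hN : N < n
  · exact Or.inl ⟨hn, hN⟩
  · exact Or.inr (not_lt.1 hN)

lemma above_inf (t : Finset ℕ) {A : Set ℕ} (hA : A.Infinite) : (above t A).Infinite := by
  refine (inf_gt hA (t.sup id)).mono ?_
  rintro n ⟨h1, h2⟩
  exact ⟨h1, fun k hk => lt_of_le_of_lt (Finset.le_sup (f := id) hk) h2⟩

lemma fusion (D : Finset ℕ → Set ℕ → Prop) (A : Set ℕ) (hA : A.Infinite)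
    (mono : ∀ t B C, C.Infinite → C ⊆ B → D t B → D t C)
    (dense : ∀ t B, B ⊆ A → B.Infinite → ∃ C ⊆ B, C.Infinite ∧ D t C) :
    ∃ B ⊆ A, B.Infinite ∧ ∀ t : Finset ℕ, (↑t : Set ℕ) ⊆ B → D t (above t B) := by
  have fin : ∀ T : Finset (Finset ℕ), ∀ B, B ⊆ A → B.Infinite →
      ∃ C ⊆ B, C.Infinite ∧ ∀ t ∈ T, D t C := by
    intro T
    induction T using Finset.induction_on with
    | empty => intro B _ hB; exact ⟨B, subset_rfl, hB, by simp⟩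
    | insert a T _ ih =>
      intro B hBA hB
      obtain ⟨C, hC, hCi, hT⟩ := ih B hBA hB
      obtain ⟨E, hE, hEi, hD⟩ := dense a C (hC.trans hBA) hCi
      refine ⟨E, hE.trans hC, hEi, ?_⟩
      intro t ht
      rcases Finset.mem_insert.1 ht with rfl | h
      · exact hD
      · exact mono t C E hEi hE (hT t h)
  obtain ⟨A0, hA0, hA0i, hD0⟩ := dense ∅ A subset_rfl hA
  have step : ∀ S : {S : Set ℕ // S ⊆ A ∧ S.Infinite}, ∃ R : {S : Set ℕ // S ⊆ A ∧ S.Infinite},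
      R.1 ⊆ S.1 ∧ (∀ n ∈ R.1, sInf S.1 < n) ∧
      ∀ t ∈ (Finset.range (sInf S.1 + 1)).powerset, D t R.1 := by
    rintro ⟨S, hSA, hS⟩
    obtain ⟨C, hC, hCi, hT⟩ := fin (Finset.range (sInf S + 1)).powerset {n ∈ S | sInf S < n}
      (fun n hn => hSA hn.1) (inf_gt hS _)
    exact ⟨⟨C, fun n hn => hSA (hC hn).1, hCi⟩, fun n hn => (hC hn).1, fun n hn => (hC hn).2, hT⟩
  choose F hF1 hF2 hF3 using step
  let S : ℕ → {S : Set ℕ // S ⊆ A ∧ S.Infinite} := fun k =>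
    Nat.rec ⟨A0, hA0, hA0i⟩ (fun _ R => F R) k
  have hS : ∀ k, S (k+1) = F (S k) := fun k => rfl
  have anti : Antitone (fun k => (S k).1) := antitone_nat_of_succ_le (fun k => by
    rw [hS]; exact hF1 _)
  let e : ℕ → ℕ := fun k => sInf (S k).1
  have he : ∀ k, e k ∈ (S k).1 := fun k => Nat.sInf_mem (S k).2.2.nonempty
  have emono : StrictMono e := strictMono_nat_of_lt_succ (fun k => by
    have h := he (k+1)
    have : ∀ n ∈ (S (k+1)).1, sInf (S k).1 < n := by rw [hS]; exact hF2 _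
    exact this _ h)
  have hBi : (range e).Infinite := Set.infinite_range_of_injective emono.injective
  refine ⟨range e, ?_, hBi, ?_⟩
  · rintro _ ⟨k, rfl⟩; exact (S k).2.1 (he k)
  · intro t ht
    rcases t.eq_empty_or_nonempty with rfl | hne
    · refine mono _ A0 _ (above_inf _ hBi) ?_ hD0
      rintro n ⟨⟨k, rfl⟩, _⟩
      exact anti (Nat.zero_le k) (he k)
    · obtain ⟨k, hk⟩ := ht (Finset.max'_mem t hne)
      have hD : D t (S (k+1)).1 := by
        rw [hS]
        apply hF3
        rw [Finset.mem_powerset]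
        intro j hj
        have : j ≤ e k := hk ▸ Finset.le_max' t j hj
        exact Finset.mem_range.2 (Nat.lt_succ_of_le this)
      refine mono _ _ _ (above_inf _ hBi) ?_ hD
      rintro n ⟨⟨j, rfl⟩, hj⟩
      have : e k < e j := hk ▸ hj _ (Finset.max'_mem t hne)
      exact anti (emono.lt_iff_lt.1 this) (he j)

/-- Completely Ramsey. -/
def CR (U : Set (Set ℕ)) : Prop :=
  ∀ (s : Finset ℕ) (A : Set ℕ), A.Infinite → ∃ B ⊆ A, B.Infinite ∧
    (bas s B ⊆ U ∨ bas s B ⊆ Uᶜ)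

/-- Ramsey null. -/
def RN (U : Set (Set ℕ)) : Prop :=
  ∀ (s : Finset ℕ) (A : Set ℕ), A.Infinite → ∃ B ⊆ A, B.Infinite ∧ bas s B ⊆ Uᶜ

/-- Ellentuck open. -/
def EO (U : Set (Set ℕ)) : Prop :=
  ∀ x ∈ U, x.Infinite → ∃ m, bas (ini x m) x ⊆ U

/-- Ellentuck interior. -/
def eint (U : Set (Set ℕ)) : Set (Set ℕ) := {x | x.Infinite ∧ ∃ m, bas (ini x m) x ⊆ U}

lemma bas_ini_sub {x : Set ℕ} {s : Finset ℕ} {A : Set ℕ} (hx : x ∈ bas s A) {m : ℕ}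
    (hm : ∀ k ∈ s, k < m) : bas (ini x m) x ⊆ bas s A := by
  intro y hy
  refine ⟨hy.1, fun k hk => hy.2.1 k (mem_ini.2 ⟨hm k hk, hx.2.1 k hk⟩), fun n hn hs => ?_⟩
  apply hx.2.2 n _ hs
  by_cases h : n ∈ ini x m
  · exact (mem_ini.1 h).2
  · exact (hy.2.2 n hn h).1

lemma mem_bas_ini {x : Set ℕ} (hx : x.Infinite) (m : ℕ) : x ∈ bas (ini x m) x := by
  refine ⟨hx, fun k hk => (mem_ini.1 hk).2, fun n hn h => ⟨hn, fun k hk => ?_⟩⟩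
  have h1 := (mem_ini.1 hk).1
  have : ¬ n < m := fun h' => h (mem_ini.2 ⟨h', hn⟩)
  omega

lemma exists_bd (s : Finset ℕ) (N : ℕ) : ∃ m, N ≤ m ∧ ∀ k ∈ s, k < m :=
  ⟨max N (s.sup id + 1), le_max_left _ _, fun k hk =>
    lt_of_lt_of_le (Nat.lt_succ_of_le (Finset.le_sup (f := id) hk)) (le_max_right _ _)⟩

lemma eint_sub (U : Set (Set ℕ)) : eint U ⊆ U := fun _ ⟨hx, m, hm⟩ => hm (mem_bas_ini hx m)

lemma eint_EO (U : Set (Set ℕ)) : EO (eint U) := by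
  rintro x ⟨hx, m, hm⟩ -
  refine ⟨m, fun y hy => ⟨hy.1, m, (bas_ini_sub hy ?_).trans hm⟩⟩
  intro k hk
  exact (mem_ini.1 hk).1

lemma bas_sub_eint {s : Finset ℕ} {A : Set ℕ} {U : Set (Set ℕ)} (h : bas s A ⊆ U) :
    bas s A ⊆ eint U := by
  intro x hx
  obtain ⟨m, -, hm⟩ := exists_bd s 0
  exact ⟨hx.1, m, (bas_ini_sub hx hm).trans h⟩

lemma CR.compl {U : Set (Set ℕ)} (h : CR U) : CR Uᶜ := by
  intro s A hA
  obtain ⟨B, hB, hBi, h⟩ := h s A hA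
  exact ⟨B, hB, hBi, by rw [compl_compl]; exact h.symm⟩

lemma EO.CR {U : Set (Set ℕ)} (hU : EO U) : CR U := by
  intro s A hA
  let rej : Set ℕ → Finset ℕ → Prop := fun B t => ∀ C ⊆ B, C.Infinite → ¬ bas t C ⊆ U
  obtain ⟨B, hBA, hBi, hB⟩ := fusion (fun t B => bas (s ∪ t) B ⊆ U ∨ rej B (s ∪ t)) A hA
    (by
      rintro t B C hC hCB (h | h)
      · exact Or.inl ((bas_mono hCB).trans h)
      · exact Or.inr fun E hE hEi => h E (hE.trans hCB) hEi)
    (by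
      intro t B _ hBi
      by_cases h : rej B (s ∪ t)
      · exact ⟨B, subset_rfl, hBi, Or.inr h⟩
      · simp only [rej] at h
        push Not at h
        obtain ⟨C, hC, hCi, h⟩ := h
        exact ⟨C, hC, hCi, Or.inl h⟩)
  have dec : ∀ t : Finset ℕ, (↑t : Set ℕ) ⊆ B → bas (s ∪ t) B ⊆ U ∨ rej B (s ∪ t) := by
    intro t ht
    rcases hB t ht with h | h
    · exact Or.inl ((bas_above Finset.subset_union_right).trans h)
    · refine Or.inr fun C hC hCi hCU => h (above t C) ?_ (above_inf t hCi) ?_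
      · intro n hn; exact ⟨hC hn.1, hn.2⟩
      · exact (bas_mono (above_sub _ _)).trans hCU
  rcases dec ∅ (by simp) with h0 | h0
  · exact ⟨B, hBA, hBi, Or.inl (by simpa using h0)⟩
  obtain ⟨C, hCB, hCi, hC⟩ := fusion (fun t E => (↑t : Set ℕ) ⊆ B → rej B (s ∪ t) →
      ∀ n ∈ E, (∀ k ∈ s ∪ t, k < n) → rej B (s ∪ insert n t)) B hBi
    (by
      intro t E E' _ hE' h ht hr n hn
      exact h ht hr n (hE' hn))
    (by
      intro t E hEB hEi
      by_cases ht : (↑t : Set ℕ) ⊆ B ∧ rej B (s ∪ t)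
      swap
      · exact ⟨E, subset_rfl, hEi, fun h1 h2 => absurd ⟨h1, h2⟩ ht⟩
      obtain ⟨ht, hr⟩ := ht
      let G : Set ℕ := {n ∈ E | (∀ k ∈ s ∪ t, k < n) ∧ ¬ rej B (s ∪ insert n t)}
      have hG : G.Finite := by
        by_contra hG
        refine hr G (fun n hn => hEB hn.1) hG ?_
        intro x hx
        have hne : (x \ ↑(s ∪ t)).Nonempty := (hx.1.sdiff (s ∪ t).finite_toSet).nonempty
        set n := sInf (x \ ↑(s ∪ t)) with hn
        have hmem : n ∈ x \ ↑(s ∪ t) := Nat.sInf_mem hne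
        have hnG : n ∈ G := (hx.2.2 n hmem.1 hmem.2).1
        have hd := (dec (insert n t) (by
          intro k hk
          rcases Finset.mem_insert.1 (Finset.mem_coe.1 hk) with rfl | hk
          · exact hEB hnG.1
          · exact ht hk)).resolve_right hnG.2.2
        apply hd
        refine ⟨hx.1, ?_, ?_⟩
        · intro k hk
          rw [Finset.union_insert, Finset.mem_insert] at hk
          rcases hk with rfl | hk
          · exact hmem.1
          · exact hx.2.1 k hk
        · intro j hj hjs
          rw [Finset.union_insert, Finset.mem_insert, not_or] at hjs
          refine ⟨hEB (hx.2.2 j hj hjs.2).1.1, ?_⟩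
          intro k hk
          rw [Finset.union_insert, Finset.mem_insert] at hk
          rcases hk with rfl | hk
          · exact lt_of_le_of_ne (Nat.sInf_le ⟨hj, hjs.2⟩) (Ne.symm hjs.1)
          · exact (hx.2.2 j hj hjs.2).2 k hk
      refine ⟨E \ G, sdiff_subset, hEi.diff hG, fun _ _ n hn hk => ?_⟩
      by_contra hcon
      exact hn.2 ⟨hn.1, hk, hcon⟩)
  refine ⟨C, hCB.trans hBA, hCi, Or.inr ?_⟩
  intro x hx hxU
  have key : ∀ m, rej B (s ∪ (ini x m \ s)) := by
    intro m
    induction m with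
    | zero => simpa [ini] using h0
    | succ m ih =>
      by_cases hm : m ∈ x ∧ m ∉ s
      · obtain ⟨hm, hms⟩ := hm
        have e1 : ini x (m+1) \ s = insert m (ini x m \ s) := by
          ext k
          simp only [Finset.mem_sdiff, Finset.mem_insert, mem_ini]
          constructor
          · rintro ⟨⟨h1, h2⟩, h3⟩
            by_cases hkm : k = m
            · exact Or.inl hkm
            · exact Or.inr ⟨⟨by omega, h2⟩, h3⟩
          · rintro (rfl | ⟨⟨h1, h2⟩, h3⟩)
            · exact ⟨⟨by omega, hm⟩, hms⟩
            · exact ⟨⟨by omega, h2⟩, h3⟩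
        rw [e1]
        have htC : (↑(ini x m \ s) : Set ℕ) ⊆ C := by
          intro k hk
          have hk := Finset.mem_sdiff.1 (Finset.mem_coe.1 hk)
          exact (hx.2.2 k (mem_ini.1 hk.1).2 hk.2).1
        have hlt : ∀ k ∈ ini x m \ s, k < m := fun k hk =>
          (mem_ini.1 (Finset.mem_sdiff.1 hk).1).1
        apply hC _ htC (htC.trans hCB) ih m ⟨(hx.2.2 m hm hms).1, hlt⟩
        intro k hk
        rcases Finset.mem_union.1 hk with hk | hk
        · exact (hx.2.2 m hm hms).2 k hk
        · exact hlt k hk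
      · have e1 : ini x (m+1) \ s = ini x m \ s := by
          ext k
          simp only [Finset.mem_sdiff, mem_ini]
          constructor
          · rintro ⟨⟨h1, h2⟩, h3⟩
            refine ⟨⟨?_, h2⟩, h3⟩
            by_contra hk
            have : k = m := by omega
            subst this
            exact hm ⟨h2, h3⟩
          · rintro ⟨⟨h1, h2⟩, h3⟩
            exact ⟨⟨by omega, h2⟩, h3⟩
        rw [e1]; exact ih
  obtain ⟨m, hm⟩ := hU x hxU hx.1
  obtain ⟨m', hmm, hm'⟩ := exists_bd s m
  have e2 : s ∪ (ini x m' \ s) = ini x m' := by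
    rw [Finset.union_sdiff_of_subset]
    intro k hk
    exact mem_ini.2 ⟨hm' k hk, hx.2.1 k hk⟩
  have hk := key m'
  rw [e2] at hk
  have hsubs : bas (ini x m') x ⊆ bas (ini x m) x :=
    bas_ini_sub (mem_bas_ini hx.1 m) (fun k hk => lt_of_lt_of_le (mem_ini.1 hk).1 hmm)
  refine hk (x \ ↑s) ?_ (hx.1.sdiff s.finite_toSet) ((bas_mono sdiff_subset).trans
    (hsubs.trans hm))
  intro n hn
  exact hCB (hx.2.2 n hn.1 hn.2).1

lemma RN.iUnion {N : ℕ → Set (Set ℕ)} (h : ∀ n, RN (N n)) : RN (⋃ n, N n) := by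
  intro s A hA
  obtain ⟨B, hBA, hBi, hB⟩ := fusion (fun t B => bas (s ∪ t) B ⊆ (N t.card)ᶜ) A hA
    (fun t B C _ hCB h => (bas_mono hCB).trans h)
    (fun t B _ hBi => h t.card (s ∪ t) B hBi)
  refine ⟨B, hBA, hBi, ?_⟩
  intro x hx hxN
  obtain ⟨n, hn⟩ := mem_iUnion.1 hxN
  classical
  -- the first n elements of x outside s
  have hxi : (x \ ↑s).Infinite := hx.1.sdiff s.finite_toSet
  set p : ℕ → Prop := fun k => k ∈ x \ ↑s with hp
  have hpi : (Set.ofPred p).Infinite := hxi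
  let t : Finset ℕ := (Finset.range n).image (Nat.nth p)
  have htc : t.card = n := by
    rw [Finset.card_image_of_injective _ (Nat.nth_injective hpi), Finset.card_range]
  have htp : ∀ k ∈ t, p k := by
    intro k hk
    obtain ⟨j, -, rfl⟩ := Finset.mem_image.1 hk
    exact Nat.nth_mem_of_infinite hpi j
  have htB : (↑t : Set ℕ) ⊆ B := fun k hk => (hx.2.2 k (htp k hk).1 (htp k hk).2).1
  have h1 := hB t htB
  rw [htc] at h1
  refine h1 ?_ hn
  apply bas_above Finset.subset_union_right
  refine ⟨hx.1, ?_, ?_⟩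
  · intro k hk
    rcases Finset.mem_union.1 hk with hk | hk
    · exact hx.2.1 k hk
    · exact (htp k hk).1
  · intro j hj hjs
    rw [Finset.mem_union, not_or] at hjs
    refine ⟨(hx.2.2 j hj hjs.1).1, ?_⟩
    intro k hk
    rcases Finset.mem_union.1 hk with hk | hk
    · exact (hx.2.2 j hj hjs.1).2 k hk
    · obtain ⟨i, hi, rfl⟩ := Finset.mem_image.1 hk
      have hpj : p j := ⟨hj, hjs.1⟩
      have hj2 := Nat.nth_count hpj
      rw [← hj2]
      apply Nat.nth_strictMono hpi
      by_contra hc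
      apply hjs.2
      rw [← hj2]
      have := Finset.mem_range.1 hi
      exact Finset.mem_image_of_mem _ (Finset.mem_range.2 (by omega))

lemma CR.of_ae {U N V : Set (Set ℕ)} (hU : CR U) (hN : RN N) (h1 : U \ N ⊆ V) (h2 : V ⊆ U ∪ N) :
    CR V := by
  intro s A hA
  obtain ⟨B, hB, hBi, h⟩ := hU s A hA
  obtain ⟨C, hC, hCi, h'⟩ := hN s B hBi
  refine ⟨C, hC.trans hB, hCi, ?_⟩
  rcases h with h | h
  · exact Or.inl fun x hx => h1 ⟨h (bas_mono hC hx), h' hx⟩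
  · refine Or.inr fun x hx hV => ?_
    rcases h2 hV with hU | hN
    · exact h (bas_mono hC hx) hU
    · exact h' hx hN

lemma CR.diff_eint {U : Set (Set ℕ)} (hU : CR U) : RN (U \ eint U) := by
  intro s A hA
  obtain ⟨B, hB, hBi, h⟩ := hU s A hA
  refine ⟨B, hB, hBi, ?_⟩
  rcases h with h | h
  · exact fun x hx hx' => hx'.2 (bas_sub_eint h hx)
  · exact fun x hx hx' => h hx hx'.1

lemma CR.iUnion {U : ℕ → Set (Set ℕ)} (h : ∀ n, CR (U n)) : CR (⋃ n, U n) := by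
  have hE : EO (⋃ n, eint (U n)) := by
    intro x hx hxi
    obtain ⟨n, hn⟩ := mem_iUnion.1 hx
    obtain ⟨m, hm⟩ := eint_EO _ x hn hxi
    exact ⟨m, hm.trans (subset_iUnion (fun n => eint (U n)) n)⟩
  refine hE.CR.of_ae (RN.iUnion fun n => (h n).diff_eint) ?_ ?_
  · exact sdiff_subset.trans (iUnion_mono fun n => eint_sub _)
  · intro x hx
    obtain ⟨n, hn⟩ := mem_iUnion.1 hx
    by_cases hx' : x ∈ eint (U n)
    · exact Or.inl (mem_iUnion.2 ⟨n, hx'⟩)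
    · exact Or.inr (mem_iUnion.2 ⟨n, hn, hx'⟩)

lemma CR.inter {U V : Set (Set ℕ)} (hU : CR U) (hV : CR V) : CR (U ∩ V) := by
  have h : CR (⋃ n : ℕ, if n = 0 then Uᶜ else Vᶜ) := by
    apply CR.iUnion
    intro n
    split_ifs
    · exact hU.compl
    · exact hV.compl
  have h' := h.compl
  convert h' using 1
  ext x
  simp only [mem_inter_iff, compl_iUnion, mem_iInter, mem_compl_iff]
  constructor
  · rintro ⟨h1, h2⟩ n
    split_ifs <;> simpa
  · intro h
    have h0 := h 0
    have h1 := h 1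
    simp at h0 h1
    exact ⟨h0, h1⟩

lemma CR.RN_of {N Q : Set (Set ℕ)} (hN : CR N) (h : N ⊆ (eint Qᶜ)ᶜ \ Q) : RN N := by
  intro s A hA
  obtain ⟨B, hB, hBi, h'⟩ := hN s A hA
  refine ⟨B, hB, hBi, ?_⟩
  rcases h' with h' | h'
  · exfalso
    have hx : (↑s ∪ above s B) ∈ bas s B := by
      refine ⟨(above_inf s hBi).mono subset_union_right, fun k hk => Or.inl hk, ?_⟩
      rintro n (hn | hn) hs
      · exact absurd hn hs
      · exact hn
    exact (h (h' hx)).1 (bas_sub_eint (fun y hy => (h (h' hy)).2) hx)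
  · exact h'

lemma CR.souslin {P : List ℕ → Set (Set ℕ)} (hP : ∀ s, CR (P s)) :
    CR (⋃ σ : ℕ → ℕ, ⋂ n : ℕ, P (List.ofFn fun i : Fin n => σ i)) := by
  let r : (ℕ → ℕ) → ℕ → List ℕ := fun σ n => List.ofFn fun i : Fin n => σ i
  have hr : ∀ σ n, r σ (n+1) = r σ n ++ [σ n] := by
    intro σ n
    show (List.ofFn fun i : Fin (n+1) => σ i) = _
    rw [List.ofFn_succ', List.concat_eq_append]
    rfl
  let Q : List ℕ → Set (Set ℕ) := fun s => {x | ∃ σ, r σ s.length = s ∧ ∀ n, x ∈ P (r σ n)}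
  let H : List ℕ → Set (Set ℕ) := fun s => (eint (Q s)ᶜ)ᶜ ∩ P s
  have hQP : ∀ s, Q s ⊆ P s := by
    rintro s x ⟨σ, h1, h2⟩
    rw [← h1]; exact h2 _
  have hQH : ∀ s, Q s ⊆ H s := fun s x hx =>
    ⟨fun h => eint_sub _ h hx, hQP s hx⟩
  have hHC : ∀ s, CR (H s) := fun s => (eint_EO _).CR.compl.inter (hP s)
  let N : List ℕ → Set (Set ℕ) := fun s => H s ∩ (⋃ k, H (s ++ [k]))ᶜ
  have hN : ∀ s, RN (N s) := by
    intro s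
    refine CR.RN_of (Q := Q s) ((hHC s).inter (CR.iUnion fun k => hHC _).compl) ?_
    rintro x ⟨h1, h2⟩
    refine ⟨h1.1, ?_⟩
    rintro ⟨σ, h3, h4⟩
    apply h2
    refine mem_iUnion.2 ⟨σ s.length, hQH _ ⟨σ, ?_, h4⟩⟩
    simp [hr, h3]
  obtain ⟨g, hg⟩ := exists_surjective_nat (List ℕ)
  have hNN : RN (⋃ n, N (g n)) := RN.iUnion fun n => hN _
  refine (hHC []).of_ae hNN ?_ ?_
  · rintro x ⟨hx, hxN⟩
    have ext : ∀ s, x ∈ H s → ∃ k, x ∈ H (s ++ [k]) := by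
      intro s hs
      by_contra hc
      obtain ⟨n, rfl⟩ := hg s
      exact hxN (mem_iUnion.2 ⟨n, hs, fun h => hc (mem_iUnion.1 h)⟩)
    have ext' : ∀ s, ∃ k, x ∈ H s → x ∈ H (s ++ [k]) := by
      intro s
      by_cases hs : x ∈ H s
      · obtain ⟨k, hk⟩ := ext s hs
        exact ⟨k, fun _ => hk⟩
      · exact ⟨0, fun h => absurd h hs⟩
    choose K hK using ext'
    let L : ℕ → List ℕ := fun n => Nat.rec [] (fun _ l => l ++ [K l]) n
    have hL : ∀ n, x ∈ H (L n) := by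
      intro n
      induction n with
      | zero => exact hx
      | succ n ih => exact hK _ ih
    have hrL : ∀ n, r (fun n => K (L n)) n = L n := by
      intro n
      induction n with
      | zero => rfl
      | succ n ih => exact (hr (fun n => K (L n)) n).trans (congrArg (fun l => l ++ [K (L n)]) ih)
    refine mem_iUnion.2 ⟨fun n => K (L n), mem_iInter.2 fun n => ?_⟩
    have := (hL n).2
    rw [← hrL n] at this
    exact this
  · intro x hx
    obtain ⟨σ, hσ⟩ := mem_iUnion.1 hx
    exact Or.inl (hQH _ ⟨σ, rfl, fun n => mem_iInter.1 hσ n⟩)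

lemma CR.preimage {α : Type*} [TopologicalSpace α] (φ : Set ℕ → α)
    (hφ : ∀ P, IsOpen P → EO (φ ⁻¹' P)) {P : Set α} (hP : CMeas P) : CR (φ ⁻¹' P) := by
  induction hP with
  | isOpen s hs => exact (hφ s hs).CR
  | compl s _ ih => exact ih.compl
  | iUnion f _ ih => rw [preimage_iUnion]; exact CR.iUnion ih
  | souslin P _ ih =>
    rw [preimage_iUnion]
    simp only [preimage_iInter]
    exact CR.souslin ih

open Classical in
/-- The coded set. -/
noncomputable def cod {X : Type*} (f : ℕ → ℕ → X) (x : Set ℕ) : Set X :=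
  {p | ∃ n m, p = f n m ∧ n ∈ x ∧ m ∈ x ∧ Even (Nat.count (· ∈ x) n) ∧
    Nat.count (· ∈ x) m = Nat.count (· ∈ x) n + 1}

lemma ini_agree {x y : Set ℕ} {m : ℕ} (hy : y ∈ bas (ini x m) x) {k : ℕ} (hk : k < m) :
    k ∈ y ↔ k ∈ x := by
  constructor
  · intro h
    by_cases h' : k ∈ ini x m
    · exact (mem_ini.1 h').2
    · exact (hy.2.2 k h h').1
  · intro h
    exact hy.2.1 k (mem_ini.2 ⟨hk, h⟩)

lemma cod_local {X : Type*} (f : ℕ → ℕ → X)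
    (hf : ∀ a b c d, f a b = f c d → a = c ∧ b = d) (p : X) :
    ∃ N, ∀ x y : Set ℕ, (∀ k < N, k ∈ y ↔ k ∈ x) → (p ∈ cod f y ↔ p ∈ cod f x) := by
  classical
  by_cases hp : ∃ n m, p = f n m
  · obtain ⟨n, m, rfl⟩ := hp
    refine ⟨n + m + 1, ?_⟩
    have : ∀ x y : Set ℕ, (∀ k < n + m + 1, k ∈ y ↔ k ∈ x) →
        (f n m ∈ cod f y → f n m ∈ cod f x) := by
      rintro x y h ⟨a, b, hab, h1, h2, h3, h4⟩
      obtain ⟨rfl, rfl⟩ := hf _ _ _ _ hab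
      have hc : ∀ j ≤ n + m, Nat.count (· ∈ y) j = Nat.count (· ∈ x) j := by
        intro j hj
        rw [Nat.count_eq_card_filter_range, Nat.count_eq_card_filter_range]
        congr 1
        apply Finset.filter_congr
        intro k hk
        exact h k (by have := Finset.mem_range.1 hk; omega)
      refine ⟨n, m, rfl, (h n (by omega)).1 h1, (h m (by omega)).1 h2, ?_, ?_⟩
      · rw [← hc n (by omega)]; convert h3
      · rw [hc n (by omega), hc m (by omega)] at *
        convert h4
    exact fun x y h => ⟨this x y h, this y x fun k hk => (h k hk).symm⟩
  · refine ⟨0, fun x y _ => ⟨?_, ?_⟩⟩ <;>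
    · rintro ⟨a, b, hab, -⟩
      exact absurd ⟨a, b, hab⟩ hp

lemma cod_EO {X : Type*} (f : ℕ → ℕ → X)
    (hf : ∀ a b c d, f a b = f c d → a = c ∧ b = d) (P : Set (X → Bool)) (hP : IsOpen P) :
    EO ((fun x => chi (cod f x)) ⁻¹' P) := by
  intro x hx _
  obtain ⟨I, u, hu, hIu⟩ := isOpen_pi_iff.1 hP _ hx
  choose N hN using cod_local f hf
  refine ⟨I.sup N, fun y hy => hIu ?_⟩
  intro p hp
  have : p ∈ cod f y ↔ p ∈ cod f x := hN p x y fun k hk =>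
    ini_agree hy (lt_of_lt_of_le hk (Finset.le_sup (f := N) hp))
  have h2 : chi (cod f y) p = chi (cod f x) p := by
    simp only [chi]
    exact decide_eq_decide.2 this
  show chi (cod f y) p ∈ u p
  rw [h2]
  exact (hu p hp).2

lemma chi_inj {X : Type*} : Function.Injective (chi : Set X → X → Bool) := by
  intro A B h
  ext p
  have := congrFun h p
  simpa [chi] using this

lemma exists_f {X : Type*} (A : ℕ → Set X) (hA : ∀ n, (A n).Infinite) :
    ∃ f : ℕ → ℕ → X, (∀ a b c d, f a b = f c d → a = c ∧ b = d) ∧ ∀ n m, f n m ∈ A n := by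
  classical
  have h1 : ∀ k : ℕ, ∃ t : Finset X, (↑t : Set X) ⊆ A k.unpair.1 ∧ t.card = k + 1 := fun k =>
    (hA k.unpair.1).exists_subset_card_eq (k+1)
  choose t ht htc using h1
  obtain ⟨g, hg, hgt⟩ := (Finset.all_card_le_biUnion_card_iff_exists_injective t).1 (by
    intro s
    rcases s.eq_empty_or_nonempty with rfl | hs
    · simp
    · calc s.card ≤ (Finset.range (s.max' hs + 1)).card := Finset.card_le_card (fun j hj =>
            Finset.mem_range.2 (Nat.lt_succ_of_le (s.le_max' j hj)))
        _ = (t (s.max' hs)).card := by rw [htc, Finset.card_range]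
        _ ≤ _ := Finset.card_le_card (Finset.subset_biUnion_of_mem t (s.max'_mem hs)))
  refine ⟨fun n m => g (Nat.pair n m), fun a b c d h => Nat.pair_eq_pair.1 (hg h), fun n m => ?_⟩
  have := ht _ (hgt (Nat.pair n m))
  simpa using this

lemma homog {X : Type*} (F : Set (Set X)) (hFP : F ⊆ PInf X) (hM : MFamily F) (hC : CMeasFam F)
    (f : ℕ → ℕ → X) (hf : ∀ a b c d, f a b = f c d → a = c ∧ b = d)
    (hfF : ∀ n, range (f n) ∈ F) (A : Set ℕ) (hA : A.Infinite) :
    ∃ H ⊆ A, H.Infinite ∧ ∀ x ⊆ H, x.Infinite → cod f x ∈ F := by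
  classical
  have hCR := CR.preimage (fun x => chi (cod f x)) (cod_EO f hf) hC
  obtain ⟨H, hHA, hHi, h⟩ := hCR ∅ A hA
  have hb : ∀ x ⊆ H, x.Infinite → x ∈ bas ∅ H := fun x hx hxi =>
    ⟨hxi, by simp, fun n hn _ => ⟨hx hn, by simp⟩⟩
  refine ⟨H, hHA, hHi, ?_⟩
  rcases h with h | h
  · intro x hx hxi
    obtain ⟨B, hB, hBx⟩ := h (hb x hx hxi)
    rwa [← chi_inj hBx]
  exfalso
  let q : ℕ → ℕ := Nat.nth (· ∈ H)
  have hqH : ∀ n, q n ∈ H := fun n => Nat.nth_mem_of_infinite hHi n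
  have hqm : StrictMono q := Nat.nth_strictMono hHi
  obtain ⟨B, hBF, hB⟩ := hM.2 (fun i => f (q i) '' {m ∈ H | q i < m}) (by
    intro i
    refine hM.1 _ (hfF (q i)) _ (image_subset_range _ _) ?_
    exact (inf_gt hHi _).image (fun a _ b _ hab => (hf _ _ _ _ hab).2))
  have hBi : B.Infinite := hFP hBF
  have step : ∀ N : ℕ, ∃ n m, N < n ∧ n < m ∧ n ∈ H ∧ m ∈ H ∧ f n m ∈ B := by
    intro N
    obtain ⟨p, hp⟩ := (hBi.sdiff (hB (N+1))).nonempty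
    have hp2 : p ∈ ⋃ i : ℕ, ⋃ _ : N + 1 ≤ i, f (q i) '' {m ∈ H | q i < m} := by
      by_contra hc
      exact hp.2 ⟨hp.1, hc⟩
    simp only [mem_iUnion] at hp2
    obtain ⟨i, hi, m, ⟨hm1, hm2⟩, rfl⟩ := hp2
    refine ⟨q i, m, ?_, hm2, hqH i, hm1, hp.1⟩
    have := hqm.id_le i
    simp at this
    omega
  choose n m h1 h2 h3 h4 h5 using step
  let S : ℕ → ℕ := fun k => Nat.rec 0 (fun _ r => m r) k
  have hS : ∀ k, S (k+1) = m (S k) := fun k => rfl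
  let e : ℕ → ℕ := fun j => if Even j then n (S (j/2)) else m (S (j/2))
  have he0 : ∀ k, e (2*k) = n (S k) := by intro k; simp [e]
  have he1 : ∀ k, e (2*k+1) = m (S k) := by
    intro k
    have : (2*k+1)/2 = k := by omega
    simp [e, this]
  have emono : StrictMono e := by
    apply strictMono_nat_of_lt_succ
    intro j
    rcases Nat.even_or_odd' j with ⟨k, rfl | rfl⟩
    · rw [he0, he1]; exact h2 _
    · rw [he1, show 2*k+1+1 = 2*(k+1) by ring, he0, hS]; exact h1 _
  have hcount : ∀ j, Nat.count (· ∈ range e) (e j) = j := by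
    intro j
    rw [Nat.count_eq_card_filter_range]
    have : (Finset.range (e j)).filter (· ∈ range e) = (Finset.range j).image e := by
      ext k
      simp only [Finset.mem_filter, Finset.mem_range, Finset.mem_image, mem_range]
      constructor
      · rintro ⟨hk, i, rfl⟩
        exact ⟨i, emono.lt_iff_lt.1 hk, rfl⟩
      · rintro ⟨i, hi, rfl⟩
        exact ⟨emono hi, i, rfl⟩
    rw [this, Finset.card_image_of_injective _ emono.injective, Finset.card_range]
  have hxH : range e ⊆ H := by
    rintro _ ⟨j, rfl⟩
    rcases Nat.even_or_odd' j with ⟨k, rfl | rfl⟩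
    · rw [he0]; exact h3 _
    · rw [he1]; exact h4 _
  have hcB : cod f (range e) ⊆ B := by
    rintro p ⟨a, b, rfl, ⟨i, rfl⟩, ⟨j, rfl⟩, hev, hcs⟩
    have hi := hcount i
    have hj := hcount j
    have hi' : Even i := by convert hev; exact hi.symm
    have hj' : j = i + 1 := by
      rw [← hj]; conv_rhs => rw [← hi]
      convert hcs
    obtain ⟨k, hk⟩ := hi'
    have hk : i = 2 * k := by omega
    subst hk; subst hj'
    rw [he0, he1]; exact h5 _
  have hci : (cod f (range e)).Infinite := by
    refine (Set.infinite_range_of_injective (f := fun k => f (e (2*k)) (e (2*k+1))) ?_).mono ?_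
    · intro a b hab
      have := emono.injective (hf _ _ _ _ hab).1
      omega
    · rintro _ ⟨k, rfl⟩
      refine ⟨_, _, rfl, ⟨_, rfl⟩, ⟨_, rfl⟩, ?_, ?_⟩
      · have := hcount (2*k)
        have h' : Even (2*k) := by simp
        rw [← this] at h'
        convert h'
      · have e1 := hcount (2*k)
        have e2 := hcount (2*k+1)
        have e3 : Nat.count (· ∈ range e) (e (2*k+1)) = Nat.count (· ∈ range e) (e (2*k)) + 1 := by
          rw [e1, e2]
        convert e3
  exact h (hb _ hxH (Set.infinite_range_of_injective emono.injective))
    ⟨_, hM.1 B hBF _ hcB hci, rfl⟩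

end Ell

theorem stmt11 {X : Type*} [Countable X] [Infinite X]
    (𝒜 ℬ : Set (Set X)) (h𝒜P : 𝒜 ⊆ PInf X) (hℬP : ℬ ⊆ PInf X)
    (h𝒜M : MFamily 𝒜) (hℬM : MFamily ℬ)
    (h𝒜C : CMeasFam 𝒜) (hℬC : CMeasFam ℬ) :
    MFamily (𝒜 ∩ ℬ) := by
  classical
  refine ⟨fun A hA B hB hBi => ⟨h𝒜M.1 A hA.1 B hB hBi, hℬM.1 A hA.2 B hB hBi⟩, ?_⟩
  intro A hA
  obtain ⟨f, hf, hfA⟩ := Ell.exists_f A (fun n => h𝒜P (hA n).1)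
  have hfi : ∀ n, (range (f n)).Infinite := fun n =>
    Set.infinite_range_of_injective fun a b hab => (hf _ _ _ _ hab).2
  have hfs : ∀ n, range (f n) ⊆ A n := by
    rintro n _ ⟨m, rfl⟩; exact hfA n m
  obtain ⟨H, -, hHi, hH⟩ := Ell.homog 𝒜 h𝒜P h𝒜M h𝒜C f hf
    (fun n => h𝒜M.1 _ (hA n).1 _ (hfs n) (hfi n)) univ infinite_univ
  obtain ⟨K, hKH, hKi, hK⟩ := Ell.homog ℬ hℬP hℬM hℬC f hf
    (fun n => hℬM.1 _ (hA n).2 _ (hfs n) (hfi n)) H hHi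
  refine ⟨Ell.cod f K, ⟨hH K hKH hKi, hK K subset_rfl hKi⟩, fun N => ?_⟩
  refine ((Set.finite_Iio N).image
    (fun n => f n (Nat.nth (· ∈ K) (Nat.count (· ∈ K) n + 1)))).subset ?_
  rintro p ⟨⟨a, b, rfl, ha, hb, -, hc⟩, hp⟩
  refine ⟨a, ?_, ?_⟩
  · by_contra hcon
    apply hp
    simp only [mem_iUnion]
    exact ⟨a, not_lt.1 hcon, hfA a b⟩
  · have hc' : Nat.count (· ∈ K) b = Nat.count (· ∈ K) a + 1 := by convert hc
    show f a _ = f a b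
    rw [← hc', Nat.nth_count (p := (· ∈ K)) hb]
end

section
/- Let 𝒜, ℬ ⊆ 𝒫∞(ℕ) be two M-families. If 𝒜 and ℬ are C-measurable, then the diagonal product 𝒜 ⊗ ℬ = {A ⊗ B : A ∈ 𝒜, B ∈ ℬ} ⊆ 𝒫∞(ℕ × ℕ) is an M-family. -/
open Set

/-- The diagonal product `A ⊗ B = {(x_n, y_n) : n ∈ ℕ}` of two infinite subsets of `ℕ`
with increasing enumerations `A = {x_0 < x_1 < ...}`, `B = {y_0 < y_1 < ...}`. -/
noncomputable def otimes (A B : Set ℕ) : Set (ℕ × ℕ) :=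
  Set.range fun n : ℕ => (Nat.nth (· ∈ A) n, Nat.nth (· ∈ B) n)

/-- The diagonal product `𝒜 ⊗ ℬ` of two families. -/
def tensorFam (F G : Set (Set ℕ)) : Set (Set (ℕ × ℕ)) :=
  {S | ∃ A ∈ F, ∃ B ∈ G, S = otimes A B}

/-! ### Completely Ramsey sets -/

/-- Ellentuck neighbourhood. -/
def Nb (s : Finset ℕ) (A : Set ℕ) : Set (Set ℕ) :=
  {X | X.Infinite ∧ (∀ x ∈ s, x ∈ X) ∧ ∀ x ∈ X, x ∉ s → x ∈ A ∧ ∀ y ∈ s, y < x}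

/-- Finite extensions of `s` by elements of `A`. -/
def FExt (s : Finset ℕ) (A : Set ℕ) (t : Finset ℕ) : Prop :=
  s ⊆ t ∧ ∀ x ∈ t, x ∉ s → x ∈ A ∧ ∀ y ∈ s, y < x

/-- Initial segments. -/
def InitSeg (t : Finset ℕ) (X : Set ℕ) : Prop :=
  (∀ x ∈ t, x ∈ X) ∧ ∀ x ∈ X, x ∉ t → ∀ y ∈ t, y < x

def above (s : Finset ℕ) : Set ℕ := {x | ∀ y ∈ s, y < x}

/-- Completely Ramsey. -/
def CR (S : Set (Set ℕ)) : Prop :=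
  ∀ (s : Finset ℕ) (A : Set ℕ), A.Infinite →
    ∃ B, B ⊆ A ∧ B.Infinite ∧ (Nb s B ⊆ S ∨ Nb s B ⊆ Sᶜ)

lemma inf_above {A : Set ℕ} (hA : A.Infinite) (s : Finset ℕ) : (A ∩ above s).Infinite := by
  have : A ⊆ (A ∩ above s) ∪ Set.Iic (s.sup id) := by
    intro x hx
    by_cases h : x ≤ s.sup id
    · exact Or.inr h
    · refine Or.inl ⟨hx, fun y hy => ?_⟩
      have := Finset.le_sup (f := id) hy
      simp only [id] at this
      omega
  intro hf
  exact hA ((hf.union (Set.finite_Iic _)).subset this)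

lemma Nb_mono {s : Finset ℕ} {A B : Set ℕ} (h : B ⊆ A) : Nb s B ⊆ Nb s A :=
  fun _ hX => ⟨hX.1, hX.2.1, fun x hx hs => ⟨h (hX.2.2 x hx hs).1, (hX.2.2 x hx hs).2⟩⟩

lemma Nb_above (s : Finset ℕ) (A : Set ℕ) : Nb s (A ∩ above s) = Nb s A := by
  apply Set.Subset.antisymm (Nb_mono Set.inter_subset_left)
  intro X hX
  exact ⟨hX.1, hX.2.1, fun x hx hs => ⟨⟨(hX.2.2 x hx hs).1, (hX.2.2 x hx hs).2⟩,
    (hX.2.2 x hx hs).2⟩⟩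

lemma Nb_nonempty (s : Finset ℕ) {A : Set ℕ} (hA : A.Infinite) : (Nb s A).Nonempty := by
  refine ⟨↑s ∪ (A ∩ above s), (inf_above hA s).mono Set.subset_union_right,
    fun x hx => Or.inl hx, ?_⟩
  rintro x (hx | hx) hs
  · exact absurd hx hs
  · exact ⟨hx.1, hx.2⟩

lemma FExt.refl (s : Finset ℕ) (A : Set ℕ) : FExt s A s :=
  ⟨Finset.Subset.refl _, fun _ h h' => absurd h h'⟩

lemma FExt.mono {s t : Finset ℕ} {A B : Set ℕ} (h : FExt s B t) (hB : B ⊆ A) : FExt s A t :=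
  ⟨h.1, fun x hx hs => ⟨hB (h.2 x hx hs).1, (h.2 x hx hs).2⟩⟩

lemma Nb_of_ext {s t : Finset ℕ} {B D : Set ℕ} (h : FExt s B t) (hD : D ⊆ B) :
    Nb t D ⊆ Nb s B := by
  intro X hX
  refine ⟨hX.1, fun x hx => hX.2.1 x (h.1 hx), fun x hx hs => ?_⟩
  by_cases ht : x ∈ t
  · exact h.2 x ht hs
  · exact ⟨hD (hX.2.2 x hx ht).1, fun y hy => (hX.2.2 x hx ht).2 y (h.1 hy)⟩

lemma Nb_init {s t : Finset ℕ} {B X : Set ℕ} (hX : X ∈ Nb s B) (hi : InitSeg t X) (hst : s ⊆ t) :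
    X ∈ Nb t B ∧ FExt s B t :=
  ⟨⟨hX.1, hi.1, fun x hx ht => ⟨(hX.2.2 x hx (fun h => ht (hst h))).1, hi.2 x hx ht⟩⟩,
    hst, fun x hx hs => hX.2.2 x (hi.1 x hx) hs⟩

lemma exists_init {s : Finset ℕ} {B X : Set ℕ} (hX : X ∈ Nb s B) (m : ℕ) :
    ∃ t, s ⊆ t ∧ InitSeg t X ∧ m ≤ t.sup id := by
  classical
  obtain ⟨k, hk, hkm⟩ := hX.1.exists_gt (max m (s.sup id))
  refine ⟨(Finset.range (k+1)).filter (· ∈ X), ?_, ⟨?_, ?_⟩, ?_⟩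
  · intro x hx
    have := Finset.le_sup (f := id) hx
    simp only [id] at this
    simp only [Finset.mem_filter, Finset.mem_range]
    exact ⟨by omega, hX.2.1 x hx⟩
  · intro x hx; exact (Finset.mem_filter.1 hx).2
  · intro x hx ht y hy
    simp only [Finset.mem_filter, Finset.mem_range] at ht hy
    have : ¬ x < k + 1 := fun h => ht ⟨h, hx⟩
    omega
  · have : k ∈ (Finset.range (k+1)).filter (· ∈ X) := by simp [hk]
    have := Finset.le_sup (f := id) this
    simp only [id] at this
    omega

/-- One-step: satisfy finitely many requirements. -/
lemma finite_req {A : Set ℕ} (P : Finset ℕ → Set ℕ → Prop)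
    (mono : ∀ t C D, D ⊆ C → D.Infinite → P t C → P t D)
    (E : Finset (Finset ℕ)) (dense : ∀ t ∈ E, ∀ C ⊆ A, C.Infinite → ∃ D ⊆ C, D.Infinite ∧ P t D) :
    ∀ C ⊆ A, C.Infinite → ∃ D ⊆ C, D.Infinite ∧ ∀ t ∈ E, P t D := by
  classical
  induction E using Finset.induction_on with
  | empty => intro C _ h; exact ⟨C, subset_rfl, h, by simp⟩
  | insert a E ha ih =>
    intro C hC hi
    obtain ⟨D, hD, hDi, hP⟩ := ih (fun t ht => dense t (Finset.mem_insert_of_mem ht)) C hC hi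
    obtain ⟨D', hD', hDi', hP'⟩ := dense a (Finset.mem_insert_self _ _) D (hD.trans hC) hDi
    refine ⟨D', hD'.trans hD, hDi', fun t ht => ?_⟩
    rcases Finset.mem_insert.1 ht with rfl | ht
    · exact hP'
    · exact mono t D D' hD' hDi' (hP t ht)

lemma fusion (s : Finset ℕ) (A : Set ℕ) (hA : A.Infinite) (P : Finset ℕ → Set ℕ → Prop)
    (mono : ∀ t C D, D ⊆ C → D.Infinite → P t C → P t D)
    (tail : ∀ t C, P t (C ∩ above t) → P t C)
    (dense : ∀ t, FExt s A t → ∀ C ⊆ A, C.Infinite → ∃ D ⊆ C, D.Infinite ∧ P t D) :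
    ∃ B ⊆ A, B.Infinite ∧ ∀ t, FExt s B t → P t B := by
  classical
  obtain ⟨A0, hA0, hA0i, hP0⟩ := dense s (FExt.refl s A) (A ∩ above s) Set.inter_subset_left
    (inf_above hA s)
  have hA0A : A0 ⊆ A := hA0.trans Set.inter_subset_left
  -- step on infinite subsets of A0
  let T := {C : Set ℕ // C ⊆ A0 ∧ C.Infinite}
  have step : ∀ C : T, ∃ D : T, D.1 ⊆ C.1 ∧ (∀ x ∈ D.1, sInf C.1 < x) ∧
      ∀ t, FExt s A t → (∀ x ∈ t, x ≤ sInf C.1) → P t D.1 := by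
    rintro ⟨C, hC, hCi⟩
    obtain ⟨D, hD, hDi, hP⟩ := finite_req (A := A) P mono
      ((Finset.powerset (Finset.range (sInf C + 1))).filter (FExt s A))
      (fun t ht => dense t (Finset.mem_filter.1 ht).2) (C ∩ above {sInf C})
      (Set.inter_subset_left.trans (hC.trans hA0A)) (inf_above hCi _)
    refine ⟨⟨D, (hD.trans Set.inter_subset_left).trans hC, hDi⟩,
      hD.trans Set.inter_subset_left, fun x hx => (hD hx).2 _ (by simp), fun t ht hx => ?_⟩
    refine hP t (Finset.mem_filter.2 ⟨Finset.mem_powerset.2 fun x h => ?_, ht⟩)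
    have : x ≤ sInf C := hx x h
    simp only [Finset.mem_range]
    omega
  choose nxt hn1 hn2 hn3 using step
  let c : ℕ → T := fun n => Nat.rec ⟨A0, subset_rfl, hA0i⟩ (fun _ C => nxt C) n
  have hc : ∀ n, c (n+1) = nxt (c n) := fun n => rfl
  let x : ℕ → ℕ := fun n => sInf (c n).1
  have hxm : ∀ n, x n ∈ (c n).1 := fun n => Nat.sInf_mem (c n).2.2.nonempty
  have hanti : Antitone fun n => (c n).1 := antitone_nat_of_succ_le fun n => hn1 (c n)
  have hxs : StrictMono x := strictMono_nat_of_lt_succ fun n => hn2 (c n) _ (hxm (n+1))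
  have hxA0 : ∀ n, x n ∈ A0 := fun n => (c n).2.1 (hxm n)
  refine ⟨Set.range x, ?_, Set.infinite_range_of_injective hxs.injective, ?_⟩
  · rintro _ ⟨n, rfl⟩; exact hA0A (hxA0 n)
  intro t ht
  have hRi : (Set.range x).Infinite := Set.infinite_range_of_injective hxs.injective
  have hRA : Set.range x ⊆ A := by rintro _ ⟨n, rfl⟩; exact hA0A (hxA0 n)
  by_cases hts : t = s
  · subst hts
    refine mono _ A0 _ ?_ hRi hP0
    rintro _ ⟨n, rfl⟩; exact hxA0 n
  · have hne : t.Nonempty := by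
      by_contra h
      rw [Finset.not_nonempty_iff_eq_empty] at h
      subst h
      exact hts (Finset.subset_empty.1 ht.1).symm
    obtain ⟨z, hz, hzs⟩ : ∃ z ∈ t, z ∉ s := by
      by_contra! h
      exact hts (Finset.Subset.antisymm h ht.1)
    have hmax : t.max' hne ∉ s := by
      intro h
      have h1 := (ht.2 z hz hzs).2 _ h
      have h2 := t.le_max' z hz
      omega
    obtain ⟨n, hn⟩ := (ht.2 _ (t.max'_mem hne) hmax).1
    apply tail
    refine mono t (c (n+1)).1 _ ?_ (inf_above hRi t) (hn3 (c n) t (ht.mono hRA) ?_)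
    · rintro _ ⟨⟨m, rfl⟩, hm⟩
      have h1 := hm _ (t.max'_mem hne)
      rw [← hn] at h1
      exact hanti (Nat.succ_le_of_lt (hxs.lt_iff_lt.1 h1)) (hxm m)
    · intro y hy
      have := t.le_max' y hy
      rw [← hn] at this
      exact this

lemma CR.compl {S : Set (Set ℕ)} (h : CR S) : CR Sᶜ := by
  intro s A hA
  obtain ⟨B, hB, hi, h⟩ := h s A hA
  refine ⟨B, hB, hi, ?_⟩
  rw [compl_compl]
  exact h.symm

lemma CR_of_determined {S : Set (Set ℕ)} (n : ℕ)
    (h : ∀ X Y : Set ℕ, X.Infinite → Y.Infinite → (∀ i ≤ n, i ∈ X ↔ i ∈ Y) → X ∈ S → Y ∈ S) :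
    CR S := by
  intro s A hA
  refine ⟨A ∩ above {n}, Set.inter_subset_left, inf_above hA _, ?_⟩
  have key : ∀ X ∈ Nb s (A ∩ above {n}), ∀ i ≤ n, i ∈ X ↔ i ∈ s := by
    intro X hX i hi
    refine ⟨fun h => ?_, hX.2.1 i⟩
    by_contra hs
    have := (hX.2.2 i h hs).1.2 n (by simp)
    omega
  by_cases hne : (Nb s (A ∩ above {n}) ∩ S).Nonempty
  · obtain ⟨X, hX, hXS⟩ := hne
    left
    intro Y hY
    exact h X Y hX.1 hY.1 (fun i hi => (key X hX i hi).trans (key Y hY i hi).symm) hXS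
  · right
    intro Y hY hYS
    exact hne ⟨Y, hY, hYS⟩

/-- deciding lemma (monotone form) -/
lemma CR.iUnion {S : ℕ → Set (Set ℕ)} (h : ∀ n, CR (S n)) : CR (⋃ n, S n) := by
  classical
  intro s A hA
  set U := ⋃ n, S n with hU
  -- first fusion
  obtain ⟨B, hBA, hBi, hB⟩ := fusion s A hA
    (fun t C => (Nb t C ⊆ U ∨ ∀ D ⊆ C, D.Infinite → ¬ Nb t D ⊆ U) ∧
      ∀ n ∈ Finset.range (t.sup id + 1), Nb t C ⊆ S n ∨ Nb t C ⊆ (S n)ᶜ)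
    (by
      rintro t C D hDC hDi ⟨h1, h2⟩
      refine ⟨?_, fun n hn => ?_⟩
      · rcases h1 with h1 | h1
        · exact Or.inl ((Nb_mono hDC).trans h1)
        · exact Or.inr fun E hE hEi => h1 E (hE.trans hDC) hEi
      · exact (h2 n hn).imp (Nb_mono hDC).trans (Nb_mono hDC).trans)
    (by
      rintro t C ⟨h1, h2⟩
      rw [Nb_above] at h1 h2
      refine ⟨h1.imp id fun h1 D hD hDi => ?_, h2⟩
      rw [← Nb_above]
      exact h1 _ (Set.inter_subset_inter_left _ hD) (inf_above hDi t))
    (by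
      intro t _ C hC hCi
      obtain ⟨D, hDC, hDi, hD⟩ : ∃ D ⊆ C, D.Infinite ∧
          (Nb t D ⊆ U ∨ ∀ E ⊆ D, E.Infinite → ¬ Nb t E ⊆ U) := by
        by_cases hh : ∃ D ⊆ C, D.Infinite ∧ Nb t D ⊆ U
        · obtain ⟨D, h1, h2, h3⟩ := hh
          exact ⟨D, h1, h2, Or.inl h3⟩
        · push Not at hh
          exact ⟨C, subset_rfl, hCi, Or.inr hh⟩
      have : ∀ F : Finset ℕ, ∃ E ⊆ D, E.Infinite ∧
          ∀ n ∈ F, Nb t E ⊆ S n ∨ Nb t E ⊆ (S n)ᶜ := by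
        intro F
        induction F using Finset.induction_on with
        | empty => exact ⟨D, subset_rfl, hDi, by simp⟩
        | insert a F _ ih =>
          obtain ⟨E, hE, hEi, hE2⟩ := ih
          obtain ⟨E', hE', hEi', hE2'⟩ := h a t E hEi
          refine ⟨E', hE'.trans hE, hEi', fun n hn => ?_⟩
          rcases Finset.mem_insert.1 hn with rfl | hn
          · exact hE2'
          · exact (hE2 n hn).imp (Nb_mono hE').trans (Nb_mono hE').trans
      obtain ⟨E, hE, hEi, hE2⟩ := this (Finset.range (t.sup id + 1))
      refine ⟨E, hE.trans hDC, hEi, ?_, hE2⟩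
      rcases hD with h1 | h1
      · exact Or.inl ((Nb_mono hE).trans h1)
      · exact Or.inr fun G hG hGi => h1 G (hG.trans hE) hGi)
  by_cases hs : Nb s B ⊆ U
  · exact ⟨B, hBA, hBi, Or.inl hs⟩
  -- second fusion
  obtain ⟨C, hCB, hCi, hC⟩ := fusion s B hBi
    (fun t C => ¬ Nb t B ⊆ U → ∀ x ∈ C, x ∈ above t → ¬ Nb (insert x t) B ⊆ U)
    (fun t C D hDC _ h hn x hx => h hn x (hDC hx))
    (fun t C h hn x hx hxt => h hn x ⟨hx, hxt⟩ hxt)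
    (by
      intro t ht C hC hCi
      by_cases hn : Nb t B ⊆ U
      · exact ⟨C, subset_rfl, hCi, fun h => absurd hn h⟩
      by_cases hfin : {x ∈ C ∩ above t | Nb (insert x t) B ⊆ U}.Infinite
      · exfalso
        rcases (hB t ht).1 with h1 | h1
        · exact hn h1
        refine h1 _ (fun x hx => hC hx.1.1) hfin fun X hX => ?_
        -- least new element
        have hne : (X \ (t : Set ℕ)).Nonempty := (hX.1.sdiff t.finite_toSet).nonempty
        have hm := Nat.sInf_mem hne
        set x := sInf (X \ (t : Set ℕ)) with hx
        have hmem := hX.2.2 x hm.1 hm.2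
        apply hmem.1.2
        refine ⟨hX.1, ?_, ?_⟩
        · intro y hy
          rcases Finset.mem_insert.1 hy with rfl | hy
          · exact hm.1
          · exact hX.2.1 y hy
        · intro y hy hyt
          rw [Finset.mem_insert, not_or] at hyt
          have h3 := hX.2.2 y hy hyt.2
          refine ⟨hC h3.1.1.1, fun z hz => ?_⟩
          rcases Finset.mem_insert.1 hz with rfl | hz
          · have : x ≤ y := Nat.sInf_le ⟨hy, hyt.2⟩
            omega
          · exact h3.2 z hz
      · rw [Set.not_infinite] at hfin
        refine ⟨C \ {x ∈ C ∩ above t | Nb (insert x t) B ⊆ U}, Set.sdiff_subset, hCi.sdiff hfin,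
          fun _ x hx hxt hU => hx.2 ⟨⟨hx.1, hxt⟩, hU⟩⟩)
  refine ⟨C, hCB.trans hBA, hCi, Or.inr ?_⟩
  -- all extensions reject
  have rej : ∀ n, ∀ t, FExt s C t → t.card = n → ¬ Nb t B ⊆ U := by
    intro n
    induction n with
    | zero =>
      intro t ht h0
      rw [Finset.card_eq_zero] at h0
      subst h0
      have := Finset.subset_empty.1 ht.1
      subst this
      exact hs
    | succ n ih =>
      intro t ht hcard
      by_cases hts : t = s
      · rw [hts]; exact hs
      have hne : t.Nonempty := Finset.card_pos.1 (by omega)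
      obtain ⟨z, hz, hzs⟩ : ∃ z ∈ t, z ∉ s := by
        by_contra! h
        exact hts (Finset.Subset.antisymm h ht.1)
      have hmax : t.max' hne ∉ s := by
        intro h
        have h1 := (ht.2 z hz hzs).2 _ h
        have h2 := t.le_max' z hz
        omega
      have hmm := t.max'_mem hne
      set m := t.max' hne with hm
      have he : FExt s C (t.erase m) := by
        refine ⟨fun y hy => Finset.mem_erase.2 ⟨fun h => hmax (h ▸ hy), ht.1 hy⟩, fun y hy => ht.2 y (Finset.mem_of_mem_erase hy)⟩
      have h1 := ih (t.erase m) he (by rw [Finset.card_erase_of_mem hmm]; omega)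
      have h2 := hC _ he h1 m (ht.2 m hmm hmax).1 (by
        intro y hy
        have h3 := t.le_max' y (Finset.mem_of_mem_erase hy)
        have h4 := Finset.ne_of_mem_erase hy
        omega)
      rwa [Finset.insert_erase hmm] at h2
  intro X hX hXU
  obtain ⟨n, hn⟩ := Set.mem_iUnion.1 hXU
  obtain ⟨t, hst, hi, hnt⟩ := exists_init hX n
  obtain ⟨hXt, het⟩ := Nb_init hX hi hst
  refine rej _ t het rfl ?_
  rcases (hB t (het.mono hCB)).2 n (by simp only [Finset.mem_range]; omega) with h1 | h1
  · exact h1.trans (Set.subset_iUnion S n)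
  · exact absurd hn (h1 (Nb_mono hCB hXt))

/-- The σ-algebra of completely Ramsey sets. -/
@[reducible] def mCR : MeasurableSpace (Set ℕ) where
  MeasurableSet' := CR
  measurableSet_empty := fun s A hA => ⟨A, subset_rfl, hA, Or.inr (by simp)⟩
  measurableSet_compl := fun _ h => h.compl
  measurableSet_iUnion := fun _ h => CR.iUnion h

/-- restriction of a sequence -/
def rs (σ : ℕ → ℕ) (n : ℕ) : List ℕ := List.ofFn fun i : Fin n => σ i

lemma rs_length (σ : ℕ → ℕ) (n : ℕ) : (rs σ n).length = n := by simp [rs]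

lemma rs_succ (σ : ℕ → ℕ) (n : ℕ) : rs σ (n+1) = rs σ n ++ [σ n] := by
  simp only [rs]
  rw [List.ofFn_succ_last]
  simp

lemma CR.souslin {P : List ℕ → Set (Set ℕ)} (hP : ∀ u, CR (P u)) :
    CR (⋃ σ : ℕ → ℕ, ⋂ n : ℕ, P (rs σ n)) := by
  classical
  intro s A hA
  let S : List ℕ → Set (Set ℕ) := fun u => {X | ∃ σ, rs σ u.length = u ∧ ∀ n, X ∈ P (rs σ n)}
  have hS0 : (⋃ σ : ℕ → ℕ, ⋂ n : ℕ, P (rs σ n)) = S [] := by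
    ext X
    simp [S, rs]
  have hSP : ∀ u, S u ⊆ P u := by
    rintro u X ⟨σ, h1, h2⟩
    rw [← h1]; exact h2 _
  have hSs : ∀ u X, X ∈ S u → ∃ k, X ∈ S (u ++ [k]) := by
    rintro u X ⟨σ, h1, h2⟩
    refine ⟨σ u.length, σ, ?_, h2⟩
    rw [List.length_append, List.length_singleton, rs_succ, h1]
  rw [hS0]
  -- for each t, only finitely many u are considered
  let cd : List ℕ → ℕ := Encodable.encode
  let F : ℕ → Finset (List ℕ) := fun m => (Finset.range (m+1)).biUnion fun i =>
    (Encodable.decode (α := List ℕ) i).toFinset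
  have hF : ∀ u m, cd u ≤ m → u ∈ F m := by
    intro u m h
    simp only [F, Finset.mem_biUnion, Finset.mem_range]
    exact ⟨cd u, by omega, by simp [cd]⟩
  obtain ⟨B, hBA, hBi, hB⟩ := fusion s A hA
    (fun t C => ∀ u ∈ F (t.sup id), Nb t C ∩ S u = ∅ ∨
      ∀ D ⊆ C, D.Infinite → (Nb t D ∩ S u).Nonempty)
    (by
      intro t C D hDC hDi h u hu
      rcases h u hu with h | h
      · left
        exact Set.subset_empty_iff.1 (h ▸ Set.inter_subset_inter_left _ (Nb_mono hDC))
      · exact Or.inr fun E hE hEi => h E (hE.trans hDC) hEi)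
    (by
      intro t C h u hu
      have h := h u hu
      rw [Nb_above] at h
      refine h.imp id fun h D hD hDi => ?_
      rw [← Nb_above]
      exact h _ (Set.inter_subset_inter_left _ hD) (inf_above hDi t))
    (by
      intro t _ C hC hCi
      have : ∀ G : Finset (List ℕ), ∃ D ⊆ C, D.Infinite ∧ ∀ u ∈ G, Nb t D ∩ S u = ∅ ∨
          ∀ E ⊆ D, E.Infinite → (Nb t E ∩ S u).Nonempty := by
        intro G
        induction G using Finset.induction_on with
        | empty => exact ⟨C, subset_rfl, hCi, by simp⟩
        | insert a G _ ih =>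
          obtain ⟨D, hD, hDi, h⟩ := ih
          have red : ∀ E ⊆ D, ∀ u ∈ G, Nb t E ∩ S u = ∅ ∨
              ∀ E' ⊆ E, E'.Infinite → (Nb t E' ∩ S u).Nonempty := by
            intro E hE u hu
            rcases h u hu with h | h
            · left
              exact Set.subset_empty_iff.1 (h ▸ Set.inter_subset_inter_left _ (Nb_mono hE))
            · exact Or.inr fun E' hE' hEi => h E' (hE'.trans hE) hEi
          by_cases hh : ∃ E ⊆ D, E.Infinite ∧ Nb t E ∩ S a = ∅
          · obtain ⟨E, hE, hEi, h0⟩ := hh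
            refine ⟨E, hE.trans hD, hEi, fun u hu => ?_⟩
            rcases Finset.mem_insert.1 hu with rfl | hu
            · exact Or.inl h0
            · exact red E hE u hu
          · push Not at hh
            refine ⟨D, hD, hDi, fun u hu => ?_⟩
            rcases Finset.mem_insert.1 hu with rfl | hu
            · exact Or.inr hh
            · exact h u hu
      exact this _)
  -- hulls
  let Sh : List ℕ → Set (Set ℕ) := fun u =>
    {X | ∀ t, InitSeg t X → s ⊆ t → cd u ≤ t.sup id → (Nb t B ∩ S u).Nonempty}
  let Q : List ℕ → Set (Set ℕ) := fun u => Sh u ∩ P u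
  let N : List ℕ → Set (Set ℕ) := fun u => Q u \ ⋃ k : ℕ, Q (u ++ [k])
  have hSQ : ∀ u X, X ∈ Nb s B → X ∈ S u → X ∈ Q u := by
    intro u X hX hXS
    refine ⟨fun t hi hst _ => ⟨X, (Nb_init hX hi hst).1, hXS⟩, hSP u hXS⟩
  have hShM : ∀ u, @MeasurableSet _ mCR (Sh u) := by
    intro u
    have : Sh u = ⋂ t : Finset ℕ, {X | InitSeg t X → s ⊆ t → cd u ≤ t.sup id →
        (Nb t B ∩ S u).Nonempty} := by
      ext X; simp [Sh]
    rw [this]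
    refine @MeasurableSet.iInter _ _ mCR _ _ fun t => ?_
    refine CR_of_determined (t.sup id) fun X Y _ _ hXY hX hi => hX ?_
    have hle : ∀ y ∈ t, y ≤ t.sup id := fun y hy => Finset.le_sup (f := id) hy
    refine ⟨fun x hx => (hXY x (hle x hx)).2 (hi.1 x hx), fun x hx hxt y hy => ?_⟩
    by_cases h : x ≤ t.sup id
    · exact hi.2 x ((hXY x h).1 hx) hxt y hy
    · have := hle y hy
      omega
  have hQM : ∀ u, @MeasurableSet _ mCR (Q u) := fun u =>
    @MeasurableSet.inter _ mCR _ _ (hShM u) (hP u)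
  have hNM : ∀ u, @MeasurableSet _ mCR (N u) := fun u =>
    @MeasurableSet.diff _ mCR _ _ (hQM u) (@MeasurableSet.iUnion _ _ mCR _ _ fun k => hQM _)
  have hnull : ∀ u t, FExt s B t → ∀ C ⊆ B, C.Infinite → ∃ D ⊆ C, D.Infinite ∧
      Nb t D ⊆ (N u)ᶜ := by
    intro u t ht C hC hCi
    obtain ⟨D, hD, hDi, h⟩ := hNM u t C hCi
    refine ⟨D, hD, hDi, h.resolve_left fun h => ?_⟩
    have hDB := hD.trans hC
    obtain ⟨X, hX⟩ := Nb_nonempty t hDi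
    obtain ⟨t', htt', hi, hu⟩ := exists_init hX (cd u)
    have hXB := Nb_of_ext ht hDB hX
    have het' := (Nb_init hXB hi (ht.1.trans htt')).2
    have h1 := (h hX).1.1 t' hi (ht.1.trans htt') hu
    rcases hB t' het' u (hF u _ hu) with h2 | h2
    · rw [h2] at h1; exact Set.not_nonempty_empty h1
    · obtain ⟨Y, hY, hYS⟩ := h2 D hDB hDi
      have hYD : Y ∈ Nb t D := Nb_of_ext (Nb_init hX hi htt').2 subset_rfl hY
      obtain ⟨k, hk⟩ := hSs u Y hYS
      exact (h hYD).2 (Set.mem_iUnion.2 ⟨k, hSQ _ Y (Nb_of_ext ht hDB hYD) hk⟩)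
  obtain ⟨D, hDB, hDi, hD⟩ := fusion s B hBi
    (fun t C => ∀ u ∈ F (t.sup id), Nb t C ⊆ (N u)ᶜ)
    (fun t C D hDC _ h u hu => (Nb_mono hDC).trans (h u hu))
    (fun t C h => by rwa [Nb_above] at h)
    (by
      intro t ht C hC hCi
      have : ∀ G : Finset (List ℕ), ∃ D ⊆ C, D.Infinite ∧ ∀ u ∈ G, Nb t D ⊆ (N u)ᶜ := by
        intro G
        induction G using Finset.induction_on with
        | empty => exact ⟨C, subset_rfl, hCi, by simp⟩
        | insert a G _ ih =>
          obtain ⟨D, hD, hDi, h⟩ := ih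
          obtain ⟨E, hE, hEi, h'⟩ := hnull a t ht D (hD.trans hC) hDi
          refine ⟨E, hE.trans hD, hEi, fun u hu => ?_⟩
          rcases Finset.mem_insert.1 hu with rfl | hu
          · exact h'
          · exact (Nb_mono hE).trans (h u hu)
      exact this _)
  have hDN : ∀ X ∈ Nb s D, ∀ u, X ∉ N u := by
    intro X hX u
    obtain ⟨t, hst, hi, hu⟩ := exists_init hX (cd u)
    obtain ⟨h1, h2⟩ := Nb_init hX hi hst
    exact hD t h2 u (hF u _ hu) h1
  obtain ⟨E, hED, hEi, hE⟩ := hQM [] s D hDi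
  refine ⟨E, (hED.trans hDB).trans hBA, hEi, hE.imp (fun h X hX => ?_) (fun h X hX hXS => ?_)⟩
  · have hXN := hDN X (Nb_mono hED hX)
    have hnext : ∀ u, X ∈ Q u → ∃ k, X ∈ Q (u ++ [k]) := by
      intro u hu
      by_contra hne
      exact hXN u ⟨hu, fun h => hne (Set.mem_iUnion.1 h)⟩
    choose k hk using fun u : {u // X ∈ Q u} => hnext u.1 u.2
    let w : ℕ → {u // X ∈ Q u} := fun n => Nat.rec ⟨[], h hX⟩ (fun _ u => ⟨u.1 ++ [k u], hk u⟩) n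
    have hw : ∀ n, rs (fun n => k (w n)) n = (w n).1 := by
      intro n
      induction n with
      | zero => simp [rs, w]
      | succ n ih => rw [rs_succ, ih]
    refine ⟨fun n => k (w n), by simp [rs], fun n => ?_⟩
    rw [hw]
    exact (w n).2.2
  · exact h hX (hSQ [] X (Nb_mono (hED.trans hDB) hX) hXS)

lemma CR_preimage (g : Set ℕ → (ℕ → Bool)) (hg : ∀ m b, CR {X | g X m = b})
    (T : Set (ℕ → Bool)) (hT : CMeas T) : CR (g ⁻¹' T) := by
  have hm : @Measurable _ _ mCR _ g := by
    letI := mCR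
    refine measurable_pi_lambda _ fun m => measurable_to_countable' fun b => ?_
    exact hg m b
  induction hT with
  | isOpen s hs => exact hm hs.measurableSet
  | compl s _ ih => exact ih.compl
  | iUnion f _ ih => rw [Set.preimage_iUnion]; exact CR.iUnion ih
  | souslin P _ ih =>
    have := CR.souslin ih
    simp only [Set.preimage_iUnion, Set.preimage_iInter]
    exact this

lemma nth_range {x : ℕ → ℕ} (hx : StrictMono x) : Nat.nth (· ∈ Set.range x) = x := by
  have hi : (Set.ofPred (· ∈ Set.range x)).Infinite :=
    Set.infinite_range_of_injective hx.injective
  refine (StrictMono.range_inj (Nat.nth_strictMono hi) hx).1 ?_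
  rw [Nat.range_nth_of_infinite hi]
  rfl

lemma nth_sm {X : Set ℕ} (hX : X.Infinite) : StrictMono (Nat.nth (· ∈ X)) :=
  Nat.nth_strictMono (p := (· ∈ X)) hX

lemma nth_mm {X : Set ℕ} (hX : X.Infinite) (n : ℕ) : Nat.nth (· ∈ X) n ∈ X :=
  Nat.nth_mem_of_infinite (p := (· ∈ X)) hX n

lemma CR_nth (p i : ℕ) : CR {X | Nat.nth (· ∈ X) p = i} := by
  classical
  refine CR_of_determined i fun X Y hX hY hXY h => ?_
  simp only [Set.mem_ofPred_eq] at h ⊢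
  have h1 : i ∈ X := h ▸ nth_mm hX p
  have h2 : Nat.count (· ∈ X) i = p := by
    rw [← h]; exact Nat.count_nth_of_infinite (p := (· ∈ X)) hX p
  have h3 : Nat.count (· ∈ Y) i = p := by
    rw [← h2, Nat.count_eq_card_filter_range, Nat.count_eq_card_filter_range]
    congr 1
    apply Finset.filter_congr
    intro x hx
    exact (hXY x (Finset.mem_range.1 hx).le).symm
  rw [← h3]
  exact Nat.nth_count (p := (· ∈ Y)) ((hXY i le_rfl).1 h1)

/-- The set coded by `X`. -/
noncomputable def Ph (a : ℕ → ℕ → ℕ) (X : Set ℕ) : Set ℕ :=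
  Set.range fun j => a (Nat.nth (· ∈ X) (2*j)) (Nat.nth (· ∈ X) (2*j+1))

lemma CR_Ph (a : ℕ → ℕ → ℕ) (m : ℕ) : CR {X | m ∈ Ph a X} := by
  have : {X | m ∈ Ph a X} = ⋃ j : ℕ, ⋃ i : ℕ, ⋃ k : ℕ, ⋃ _ : a i k = m,
      ({X | Nat.nth (· ∈ X) (2*j) = i} ∩ {X | Nat.nth (· ∈ X) (2*j+1) = k}) := by
    ext X
    simp [Ph]
  rw [this]
  letI := mCR
  change @MeasurableSet (Set ℕ) mCR _
  exact MeasurableSet.iUnion fun j => MeasurableSet.iUnion fun i => MeasurableSet.iUnion fun k =>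
    MeasurableSet.iUnion fun _ => MeasurableSet.inter (CR_nth _ _) (CR_nth _ _)

lemma chi_inj {X : Type*} : Function.Injective (chi (X := X)) := by
  intro A B h
  ext x
  have := congrFun h x
  simpa [chi] using this

lemma key (F : Set (Set ℕ)) (hP : F ⊆ PInf ℕ) (hM : MFamily F) (hC : CMeasFam F)
    (A : ℕ → Set ℕ) (hA : ∀ n, A n ∈ F) (H : Set ℕ) (hH : H.Infinite) :
    ∃ H' ⊆ H, H'.Infinite ∧ ∀ X ⊆ H', X.Infinite →
      Ph (fun n k => Nat.nth (· ∈ A n) k) X ∈ F := by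
  set a : ℕ → ℕ → ℕ := fun n k => Nat.nth (· ∈ A n) k with ha
  have haM : ∀ n, StrictMono (a n) := fun n => nth_sm (hP (hA n))
  have hcr : CR ((fun X => chi (Ph a X)) ⁻¹' (chi '' F)) := by
    apply CR_preimage _ _ _ hC
    intro m b
    have h1 : {X | chi (Ph a X) m = true} = {X | m ∈ Ph a X} := by
      ext X; simp [chi]
    have h2 : {X | chi (Ph a X) m = false} = {X | m ∈ Ph a X}ᶜ := by
      ext X; simp [chi]
    cases b
    · rw [h2]; exact (CR_Ph a m).compl
    · rw [h1]; exact CR_Ph a m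
  obtain ⟨H', hH', hi, hor⟩ := hcr ∅ H hH
  have hNb : ∀ X ⊆ H', X.Infinite → X ∈ Nb ∅ H' := fun X hX hXi =>
    ⟨hXi, by simp, fun x hx _ => ⟨hX hx, by simp⟩⟩
  refine ⟨H', hH', hi, ?_⟩
  rcases hor with hor | hor
  · intro X hX hXi
    obtain ⟨B, hB, hBe⟩ := hor (hNb X hX hXi)
    rwa [← chi_inj hBe]
  exfalso
  set h := Nat.nth (· ∈ H') with hh
  have hsm : StrictMono h := nth_sm hi
  have hinf : ∀ n, (a n '' (H' ∩ above {n})).Infinite := fun n =>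
    (inf_above hi _).image (haM n).injective.injOn
  obtain ⟨B, hBF, hB⟩ := hM.2 (fun j => a (h j) '' (H' ∩ above {h j})) (fun j => by
    refine hM.1 _ (hA (h j)) _ ?_ (hinf _)
    rintro _ ⟨k, _, rfl⟩
    exact nth_mm (hP (hA (h j))) k)
  have hBi : B.Infinite := hP hBF
  have step : ∀ n, ∃ i k, n < i ∧ i < k ∧ i ∈ H' ∧ k ∈ H' ∧ a i k ∈ B := by
    intro n
    have hne : (B \ (B \ ⋃ i : ℕ, ⋃ _ : n + 1 ≤ i, a (h i) '' (H' ∩ above {h i}))).Nonempty :=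
      (hBi.sdiff (hB (n+1))).nonempty
    obtain ⟨y, hy, hy'⟩ := hne
    have : y ∈ ⋃ i : ℕ, ⋃ _ : n + 1 ≤ i, a (h i) '' (H' ∩ above {h i}) := by
      by_contra hc; exact hy' ⟨hy, hc⟩
    simp only [Set.mem_iUnion] at this
    obtain ⟨j, hj, k, hk, rfl⟩ := this
    have := hsm.le_apply (x := j)
    exact ⟨h j, k, by omega, hk.2 _ (by simp), nth_mm hi j, hk.1, hy⟩
  choose I K h1 h2 h3 h4 h5 using step
  let c : ℕ → ℕ := fun n => Nat.rec 0 (fun _ m => K m) n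
  have hc : ∀ n, c (n+1) = K (c n) := fun _ => rfl
  let x : ℕ → ℕ := fun n => if n % 2 = 0 then I (c (n/2)) else K (c (n/2))
  have hx0 : ∀ j, x (2*j) = I (c j) := by
    intro j
    have e1 : 2*j % 2 = 0 := by omega
    have e2 : 2*j / 2 = j := by omega
    simp [x]
  have hx1 : ∀ j, x (2*j+1) = K (c j) := by
    intro j
    have e1 : (2*j+1) % 2 = 1 := by omega
    have e2 : (2*j+1) / 2 = j := by omega
    simp [x, e1, e2]
  have hx : StrictMono x := by
    refine strictMono_nat_of_lt_succ fun n => ?_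
    obtain ⟨j, rfl | rfl⟩ := n.even_or_odd'
    · rw [hx0, hx1]; exact h2 _
    · rw [hx1, show 2*j+1+1 = 2*(j+1) by ring, hx0, hc]; exact h1 _
  have hxr : Set.range x ⊆ H' := by
    rintro _ ⟨n, rfl⟩
    obtain ⟨j, rfl | rfl⟩ := n.even_or_odd'
    · rw [hx0]; exact h3 _
    · rw [hx1]; exact h4 _
  have hxi : (Set.range x).Infinite := Set.infinite_range_of_injective hx.injective
  refine hor (hNb _ hxr hxi) ⟨Ph a (Set.range x), ?_, rfl⟩
  have hPh : Ph a (Set.range x) = Set.range fun j => a (x (2*j)) (x (2*j+1)) := by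
    simp only [Ph, nth_range hx]
  rw [hPh]
  refine hM.1 B hBF _ ?_ ?_
  · rintro _ ⟨j, rfl⟩
    simp only [hx0, hx1]; exact h5 _
  · refine Set.infinite_of_forall_exists_gt fun n => ⟨_, ⟨n, rfl⟩, ?_⟩
    have e1 := (haM (x (2*n))).le_apply (x := x (2*n+1))
    have e2 := hx.le_apply (x := 2*n+1)
    change n < a (x (2*n)) (x (2*n+1))
    omega

lemma otimes_range {x y : ℕ → ℕ} (hx : StrictMono x) (hy : StrictMono y) :
    otimes (Set.range x) (Set.range y) = Set.range fun n => (x n, y n) := by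
  simp only [otimes, nth_range hx, nth_range hy]

theorem stmt12 (𝒜 ℬ : Set (Set ℕ)) (h𝒜P : 𝒜 ⊆ PInf ℕ) (hℬP : ℬ ⊆ PInf ℕ)
    (h𝒜M : MFamily 𝒜) (hℬM : MFamily ℬ)
    (h𝒜C : CMeasFam 𝒜) (hℬC : CMeasFam ℬ) :
    MFamily (tensorFam 𝒜 ℬ) := by
  refine ⟨?_, ?_⟩
  · rintro S ⟨A, hA, B, hB, rfl⟩ T hT hTi
    have hAi : A.Infinite := h𝒜P hA
    have hBi : B.Infinite := hℬP hB
    set f : ℕ → ℕ × ℕ := fun n => (Nat.nth (· ∈ A) n, Nat.nth (· ∈ B) n) with hf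
    have hTf : f '' (f ⁻¹' T) = T := Set.image_preimage_eq_of_subset hT
    have hJ : (f ⁻¹' T).Infinite := by
      intro h
      exact hTi (hTf ▸ h.image f)
    have hn := nth_sm hJ
    have hx : StrictMono (fun n => Nat.nth (· ∈ A) (Nat.nth (· ∈ f ⁻¹' T) n)) :=
      (nth_sm hAi).comp hn
    have hy : StrictMono (fun n => Nat.nth (· ∈ B) (Nat.nth (· ∈ f ⁻¹' T) n)) :=
      (nth_sm hBi).comp hn
    refine ⟨_, h𝒜M.1 A hA (Set.range _) ?_ (Set.infinite_range_of_injective hx.injective),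
      _, hℬM.1 B hB (Set.range _) ?_ (Set.infinite_range_of_injective hy.injective), ?_⟩
    · rintro _ ⟨n, rfl⟩; exact nth_mm hAi _
    · rintro _ ⟨n, rfl⟩; exact nth_mm hBi _
    · rw [otimes_range hx hy]
      conv_lhs => rw [← hTf]
      have hr : Set.range (Nat.nth (· ∈ f ⁻¹' T)) = f ⁻¹' T :=
        Nat.range_nth_of_infinite (p := (· ∈ f ⁻¹' T)) hJ
      conv_lhs => rw [← hr]
      rw [← Set.range_comp]
      rfl
  · intro C hC
    choose A hA B hB hCe using hC
    have hAi : ∀ n, (A n).Infinite := fun n => h𝒜P (hA n)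
    have hBi : ∀ n, (B n).Infinite := fun n => hℬP (hB n)
    obtain ⟨H, -, hHi, hH⟩ := key 𝒜 h𝒜P h𝒜M h𝒜C A hA Set.univ Set.infinite_univ
    obtain ⟨H', hH'H, hHi', hH'⟩ := key ℬ hℬP hℬM hℬC B hB H hHi
    have hH1 := hH H' hH'H hHi'
    have hH2 := hH' H' subset_rfl hHi'
    set x := Nat.nth (· ∈ H') with hx
    have hxm : StrictMono x := nth_sm hHi'
    set α : ℕ → ℕ := fun j => Nat.nth (· ∈ A (x (2*j))) (x (2*j+1)) with hα
    set β : ℕ → ℕ := fun j => Nat.nth (· ∈ B (x (2*j))) (x (2*j+1)) with hβ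
    have hαt : Filter.Tendsto α Filter.atTop Filter.atTop := by
      refine Filter.tendsto_atTop_mono (fun j => ?_) Filter.tendsto_id
      have e1 := (nth_sm (hAi (x (2*j)))).le_apply (x := x (2*j+1))
      have e2 := hxm.le_apply (x := 2*j+1)
      simp only [id, hα]
      omega
    have hβt : Filter.Tendsto β Filter.atTop Filter.atTop := by
      refine Filter.tendsto_atTop_mono (fun j => ?_) Filter.tendsto_id
      have e1 := (nth_sm (hBi (x (2*j)))).le_apply (x := x (2*j+1))
      have e2 := hxm.le_apply (x := 2*j+1)
      simp only [id, hβ]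
      omega
    obtain ⟨φ, hφ, hφα⟩ := Filter.strictMono_subseq_of_tendsto_atTop hαt
    obtain ⟨ψ, hψ, hψβ⟩ := Filter.strictMono_subseq_of_tendsto_atTop (hβt.comp hφ.tendsto_atTop)
    have hα' : StrictMono (fun n => α (φ (ψ n))) := hφα.comp hψ
    have hβ' : StrictMono (fun n => β (φ (ψ n))) := hψβ
    refine ⟨otimes (Set.range fun n => α (φ (ψ n))) (Set.range fun n => β (φ (ψ n))),
      ⟨_, h𝒜M.1 _ hH1 _ ?_ (Set.infinite_range_of_injective hα'.injective),
      _, hℬM.1 _ hH2 _ ?_ (Set.infinite_range_of_injective hβ'.injective), rfl⟩, ?_⟩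
    · rintro _ ⟨n, rfl⟩; exact ⟨φ (ψ n), rfl⟩
    · rintro _ ⟨n, rfl⟩; exact ⟨φ (ψ n), rfl⟩
    · intro n
      rw [otimes_range hα' hβ']
      refine ((Set.finite_Iio n).image fun n => (α (φ (ψ n)), β (φ (ψ n)))).subset ?_
      rintro _ ⟨⟨j, rfl⟩, hj⟩
      refine ⟨j, ?_, rfl⟩
      by_contra hjn
      apply hj
      simp only [Set.mem_Iio, not_lt] at hjn
      simp only [Set.mem_iUnion]
      have e1 := hφ.le_apply (x := ψ j)
      have e2 := hψ.le_apply (x := j)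
      have e3 := hxm.le_apply (x := 2 * φ (ψ j))
      refine ⟨x (2 * φ (ψ j)), by omega, ?_⟩
      rw [hCe]
      exact ⟨x (2 * φ (ψ j) + 1), rfl⟩
end

section
/- Let X, Y be two countable infinite sets and τ₁, τ₂ analytic topologies on X and Y respectively. If both (X, τ₁) and (Y, τ₂) have the weak diagonal sequence property, then the product space (X × Y, τ₁ × τ₂) has the weak diagonal sequence property. -/
open Set

/-- A point `z` has the weak diagonal sequence property: for every doubly indexed
sequence `(y n k)` with `lim_k y n k = z` for each `n`, there are an infinite `L ⊆ ℕ`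
and indices `k n` such that `(y n (k n))_{n ∈ L}` converges to `z`. -/
def WDSPpt {Z : Type*} [TopologicalSpace Z] (z : Z) : Prop :=
  ∀ y : ℕ → ℕ → Z, (∀ n, Filter.Tendsto (y n) Filter.atTop (nhds z)) →
    ∃ L : Set ℕ, L.Infinite ∧ ∃ k : ℕ → ℕ,
      ∀ U ∈ nhds z, {n ∈ L | y n (k n) ∉ U}.Finite

/-- A space has the weak diagonal sequence property if every point has it. -/
def WDSP (Z : Type*) [TopologicalSpace Z] : Prop := ∀ z : Z, WDSPpt z

/-- A topology on a countable set `X` is analytic if the collection of open sets,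
viewed as a subset of `2^X = X → Bool`, is an analytic set. -/
def AnalyticTopology (X : Type*) [TopologicalSpace X] : Prop :=
  AnalyticFam {s : Set X | IsOpen s}

open Filter

namespace WD

def pre (M : ℕ → ℕ) (j : ℕ) : List ℕ := (List.range j).map M

theorem pre_len (M : ℕ → ℕ) (j : ℕ) : (pre M j).length = j := by simp [pre]

theorem pre_succ (M : ℕ → ℕ) (j : ℕ) : pre M (j+1) = pre M j ++ [M j] := by
  simp [pre, List.range_succ]

theorem pre_take (M : ℕ → ℕ) (i j : ℕ) (h : i ≤ j) : (pre M j).take i = pre M i := by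
  simp [pre, ← List.map_take, List.take_range, h]

theorem pre_agree {M N : ℕ → ℕ} {j : ℕ} (h : pre M j = pre N j) : ∀ i < j, M i = N i := by
  intro i hi
  have := List.map_inj_left.1 h
  exact this i (by simpa using hi)

variable (V : Ultrafilter ℕ)

/-- `M` extends `s` and follows the tree `a` afterwards. -/
def Br (a : List ℕ → Set ℕ) (s : List ℕ) (M : ℕ → ℕ) : Prop :=
  pre M s.length = s ∧ ∀ j, s.length ≤ j → M j ∈ a (pre M j)

def Forces (s : List ℕ) (Φ : (ℕ → ℕ) → Prop) : Prop :=
  ∃ a : List ℕ → Set ℕ, (∀ t, a t ∈ V) ∧ ∀ M, Br a s M → Φ M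

variable {V}

theorem Forces.mono {s : List ℕ} {Φ Ψ : (ℕ → ℕ) → Prop} (h : Forces V s Φ)
    (hi : ∀ M, Φ M → Ψ M) : Forces V s Ψ := by
  obtain ⟨a, ha, hM⟩ := h
  exact ⟨a, ha, fun M h => hi M (hM M h)⟩

theorem Forces.and {s : List ℕ} {Φ Ψ : (ℕ → ℕ) → Prop} (h : Forces V s Φ) (h' : Forces V s Ψ) :
    Forces V s (fun M => Φ M ∧ Ψ M) := by
  obtain ⟨a, ha, hM⟩ := h
  obtain ⟨b, hb, hN⟩ := h'
  exact ⟨fun t => a t ∩ b t, fun t => Filter.inter_mem (ha t) (hb t), fun M h =>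
    ⟨hM M ⟨h.1, fun j hj => (h.2 j hj).1⟩, hN M ⟨h.1, fun j hj => (h.2 j hj).2⟩⟩⟩

theorem forces_step {s : List ℕ} {Φ : (ℕ → ℕ) → Prop}
    (h : {n | Forces V (s ++ [n]) Φ} ∈ V) : Forces V s Φ := by
  classical
  have : ∀ u : List ℕ, ∃ a : List ℕ → Set ℕ, (∀ t, a t ∈ V) ∧
      (Forces V u Φ → ∀ M, Br a u M → Φ M) := by
    intro u
    by_cases hu : Forces V u Φ
    · obtain ⟨a, ha, hM⟩ := hu
      exact ⟨a, ha, fun _ => hM⟩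
    · exact ⟨fun _ => univ, fun _ => Filter.univ_mem, fun h => absurd h hu⟩
  choose K hK hKM using this
  refine ⟨fun t => {n | Forces V (s ++ [n]) Φ} ∩ K (t.take (s.length + 1)) t,
    fun t => Filter.inter_mem h (hK _ _), ?_⟩
  intro M ⟨h1, h2⟩
  have h3 : Forces V (s ++ [M s.length]) Φ := (h2 s.length le_rfl).1
  have h4 : pre M (s.length + 1) = s ++ [M s.length] := by rw [pre_succ, h1]
  refine hKM _ h3 M ⟨by simpa using h4, fun j hj => ?_⟩
  have hj' : s.length + 1 ≤ j := by simpa using hj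
  have := (h2 j (by omega)).2
  rwa [pre_take _ _ _ hj', h4] at this

theorem forces_always {s : List ℕ} {Q : List ℕ → Prop} (hs : Q s)
    (hQ : ∀ t, Q t → {n | Q (t ++ [n])} ∈ V) :
    Forces V s (fun M => ∀ j, s.length ≤ j → Q (pre M j)) := by
  classical
  refine ⟨fun t => if Q t then {n | Q (t ++ [n])} else univ, fun t => ?_, ?_⟩
  · dsimp only
    split_ifs with h
    · exact hQ t h
    · exact Filter.univ_mem
  · intro M ⟨h1, h2⟩ j hj
    induction j, hj using Nat.le_induction with
    | base => rwa [h1]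
    | succ j hj ih =>
      have := h2 j hj
      simp only [ih, if_true] at this
      rw [pre_succ]
      exact this

theorem fusion {ι : Type} [Encodable ι] (Ψ : ι → (ℕ → ℕ) → Prop) (s : List ℕ) :
    Forces V s (fun M => ∀ i j, s.length ≤ j → Encodable.encode i ≤ j →
      Forces V (pre M j) (Ψ i) → Ψ i M) := by
  classical
  have : ∀ (u : List ℕ) (i : ι), ∃ a : List ℕ → Set ℕ, (∀ t, a t ∈ V) ∧
      (Forces V u (Ψ i) → ∀ M, Br a u M → Ψ i M) := by
    intro u i
    by_cases hu : Forces V u (Ψ i)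
    · obtain ⟨a, ha, hM⟩ := hu
      exact ⟨a, ha, fun _ => hM⟩
    · exact ⟨fun _ => univ, fun _ => Filter.univ_mem, fun h => absurd h hu⟩
  choose K hK hKM using this
  refine ⟨fun t => ⋂ l ∈ Set.Iic t.length, ⋂ i ∈ {i : ι | Encodable.encode i ≤ t.length},
    K (t.take l) i t, fun t => ?_, ?_⟩
  · refine (Filter.biInter_mem (Set.finite_Iic _)).2 fun l _ => ?_
    refine (Filter.biInter_mem ?_).2 fun i _ => hK _ _ _
    exact (Set.finite_Iic t.length).preimage (Encodable.encode_injective.injOn)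
  · intro M ⟨h1, h2⟩ i j hj hij hF
    refine hKM _ i hF M ⟨by rw [pre_len], fun j' hj' => ?_⟩
    rw [pre_len] at hj'
    have h3 := h2 j' (hj.trans hj')
    simp only [Set.mem_iInter, Set.mem_Iic, Set.mem_ofPred_eq, pre_len] at h3
    have h4 := h3 j hj' i (hij.trans hj')
    rwa [pre_take _ _ _ hj'] at h4

variable (V) in
def Killed (C : (ℕ → ℕ) → (ℕ → ℕ) → Prop) (s σ : List ℕ) : Prop :=
  Forces V s (fun M => ∀ z, pre z σ.length = σ → ¬ C M z)

def code (σ : List ℕ) : ℕ := Encodable.encode σ + σ.length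

variable (V) in
def Base (C : (ℕ → ℕ) → (ℕ → ℕ) → Prop) (σ t : List ℕ) : Prop :=
  ∃ m, code (σ ++ [m]) ≤ t.length ∧ ¬ Killed V C t (σ ++ [m])

theorem jump {C : (ℕ → ℕ) → (ℕ → ℕ) → Prop} {s σ : List ℕ} (h : ¬ Killed V C s σ) :
    Forces V s (fun M => ∃ j, Base V C σ (pre M j)) := by
  by_contra hJ
  apply h
  have h1 := forces_always (V := V) (s := s)
    (Q := fun t => ¬ Forces V t (fun M => ∃ j, Base V C σ (pre M j))) hJ (by
      intro t ht
      have : {n | Forces V (t ++ [n]) (fun M => ∃ j, Base V C σ (pre M j))} ∉ V :=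
        fun h => ht (forces_step h)
      exact Ultrafilter.compl_mem_iff_notMem.2 this)
  have h2 := fusion (V := V)
    (fun (ρ : List ℕ) M => ∀ z, pre z ρ.length = ρ → ¬ C M z) s
  refine (h1.and h2).mono ?_
  rintro M ⟨hM1, hM2⟩ z hz
  set m := z σ.length with hm
  have hzm : pre z (σ.length + 1) = σ ++ [m] := by rw [pre_succ, hz]
  set j := max s.length (code (σ ++ [m])) with hj
  have hb : ¬ Base V C σ (pre M j) := by
    intro hb
    refine hM1 j (le_max_left _ _) ⟨fun _ => univ, fun _ => Filter.univ_mem, ?_⟩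
    intro N hN
    refine ⟨j, ?_⟩
    have := hN.1
    rw [pre_len] at this
    rwa [this]
  have hk : Killed V C (pre M j) (σ ++ [m]) := by
    by_contra hk
    exact hb ⟨m, by rw [pre_len]; exact le_max_right _ _, hk⟩
  have hc : Encodable.encode (σ ++ [m]) ≤ j :=
    (Nat.le_add_right _ _).trans (le_max_right s.length (code (σ ++ [m])))
  exact hM2 (σ ++ [m]) j (le_max_left _ _) hc hk z (by simpa using hzm)

theorem ramsey (C : (ℕ → ℕ) → (ℕ → ℕ) → Prop)
    (hC : ∀ M z, (∀ j, ∃ M' z', (∀ i < j, M' i = M i) ∧ (∀ i < j, z' i = z i) ∧ C M' z') → C M z) :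
    Forces V [] (fun M => ∀ z, ¬ C M z) ∨ Forces V [] (fun M => ∃ z, C M z) := by
  by_cases hk : Killed V C [] []
  · left
    exact hk.mono fun M h z => h z (by simp [pre])
  right
  refine ((fusion (V := V) (fun (σ : List ℕ) M => ∃ j, Base V C σ (pre M j)) []).and
    ⟨fun _ => univ, fun _ => Filter.univ_mem, fun M h => h⟩).mono ?_
  rintro M ⟨hM, -⟩
  have key : ∀ σ j, code σ ≤ j → ¬ Killed V C (pre M j) σ →
      ∃ m j', code (σ ++ [m]) ≤ j' ∧ ¬ Killed V C (pre M j') (σ ++ [m]) := by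
    intro σ j hj hn
    obtain ⟨j', m, h1, h2⟩ := hM σ j (by simp) ((Nat.le_add_right _ _).trans hj) (jump hn)
    exact ⟨m, j', by simpa [pre_len] using h1, h2⟩
  let G : List ℕ → Prop := fun σ => ∃ j, code σ ≤ j ∧ ¬ Killed V C (pre M j) σ
  have hstep : ∀ σ : {σ // G σ}, ∃ m, G (σ.1 ++ [m]) := by
    rintro ⟨σ, j, h1, h2⟩
    obtain ⟨m, j', h3, h4⟩ := key σ j h1 h2
    exact ⟨m, j', h3, h4⟩
  choose nx hnx using hstep
  have h0 : G [] := by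
    refine ⟨0, by simp [code], by simpa [pre] using hk⟩
  let S : ℕ → {σ // G σ} := fun n => Nat.rec ⟨[], h0⟩ (fun _ σ => ⟨σ.1 ++ [nx σ], hnx σ⟩) n
  let z : ℕ → ℕ := fun n => nx (S n)
  have hS : ∀ n, (S n).1 = pre z n := by
    intro n
    induction n with
    | zero => rfl
    | succ n ih =>
      rw [pre_succ, ← ih]
  refine ⟨z, hC M z fun i => ?_⟩
  obtain ⟨j, hj, hn⟩ := (S i).2
  rw [hS] at hj hn
  have hij : i ≤ j := by
    have : (pre z i).length ≤ j := (Nat.le_add_left _ _).trans hj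
    rwa [pre_len] at this
  by_contra hcon
  apply hn
  refine ⟨fun _ => univ, fun _ => Filter.univ_mem, ?_⟩
  intro M' hM' z' hz' hCC
  have h1 := hM'.1
  rw [pre_len] at h1 hz'
  exact hcon ⟨M', z', fun k hk => pre_agree h1 k (hk.trans_le hij), pre_agree hz', hCC⟩

theorem fin_lists (b : ℕ) : {t : List ℕ | t.length ≤ b ∧ ∀ x ∈ t, x < b}.Finite := by
  have h := (List.finite_length_le (Fin b) b).image (List.map Fin.val)
  refine h.subset ?_
  rintro t ⟨h1, h2⟩
  refine ⟨t.pmap (fun x hx => ⟨x, hx⟩) h2, by simpa using h1, ?_⟩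
  simp [List.map_pmap]

theorem diag (hV : (V : Filter ℕ) ≤ cofinite) {Φ : (ℕ → ℕ) → Prop} (hF : Forces V [] Φ) :
    ∃ h : ℕ → ℕ, StrictMono h ∧ ∀ φ : ℕ → ℕ, StrictMono φ → Φ (h ∘ φ) := by
  obtain ⟨a, ha, hM⟩ := hF
  have hA : ∀ b : ℕ, ∃ n, b ≤ n ∧ ∀ t : List ℕ, t.length ≤ b → (∀ x ∈ t, x < b) → n ∈ a t := by
    intro b
    have h1 : Set.Ici b ∈ V := by
      apply hV
      rw [Filter.mem_cofinite]
      simpa using Set.finite_Iio b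
    have h2 : (⋂ t ∈ {t : List ℕ | t.length ≤ b ∧ ∀ x ∈ t, x < b}, a t) ∈ V :=
      (Filter.biInter_mem (fin_lists b)).2 fun t _ => ha t
    obtain ⟨n, hn1, hn2⟩ := V.nonempty_of_mem (Filter.inter_mem h1 h2)
    simp only [Set.mem_iInter, Set.mem_ofPred_eq] at hn2
    exact ⟨n, hn1, fun t h h' => hn2 t ⟨h, h'⟩⟩
  choose nx hnx1 hnx2 using hA
  let h : ℕ → ℕ := fun n => Nat.rec (nx 0) (fun _ p => nx (p + 1)) n
  have hmono : StrictMono h := strictMono_nat_of_lt_succ fun n => hnx1 (h n + 1)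
  refine ⟨h, hmono, fun φ hφ => hM _ ⟨by simp [pre], fun j _ => ?_⟩⟩
  have hj : j ≤ φ j := hφ.id_le j
  rcases hk : φ j with _ | k
  · have : j = 0 := by omega
    subst this
    simp only [Function.comp, hk]
    exact hnx2 0 _ (by simp [pre]) (by simp [pre])
  · simp only [Function.comp, hk]
    refine hnx2 (h k + 1) _ ?_ ?_
    · rw [pre_len]
      have : k ≤ h k := hmono.id_le k
      omega
    · intro x hx
      simp only [pre, List.mem_map, List.mem_range, Function.comp] at hx
      obtain ⟨i, hi, rfl⟩ := hx
      have : φ i < φ j := hφ hi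
      have : h (φ i) ≤ h k := hmono.monotone (by omega)
      omega

/-- Main one-space lemma. -/
theorem one_space {X : Type*} [TopologicalSpace X] (hV : (V : Filter ℕ) ≤ cofinite)
    (hX : AnalyticTopology X) (x : X) (hx : WDSPpt x)
    (y : ℕ → ℕ → X) (hy : ∀ n, Tendsto (y n) atTop (nhds x)) :
    Forces V [] (fun M => ∀ U : Set X, IsOpen U → x ∈ U → ∃ i, y (M (2*i)) (M (2*i+1)) ∈ U) := by
  classical
  have hchi : ∀ (A : Set X) p, chi A p = true ↔ p ∈ A := by
    intro A p; simp [chi]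
  have hX' : MeasureTheory.AnalyticSet (chi '' {s : Set X | IsOpen s}) := hX
  rw [MeasureTheory.AnalyticSet] at hX'
  rcases hX' with h | ⟨g, hg, hr⟩
  · have hmem : chi (univ : Set X) ∈ chi '' {s : Set X | IsOpen s} := ⟨univ, isOpen_univ, rfl⟩
    rw [h] at hmem
    exact absurd hmem (Set.notMem_empty _)
  have hloc : ∀ (z : ℕ → ℕ) (p : X), ∃ j, ∀ z' : ℕ → ℕ, (∀ i < j, z' i = z i) → g z' p = g z p := by
    intro z p
    have hc : Continuous fun z => g z p := (continuous_apply p).comp hg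
    have ho : IsOpen ((fun z => g z p) ⁻¹' {g z p}) := (isOpen_discrete _).preimage hc
    obtain ⟨v, ⟨w, j, rfl⟩, hzw, hj⟩ :=
      (PiNat.isTopologicalBasis_cylinders (fun _ : ℕ => ℕ)).exists_subset_of_mem_open
        (show z ∈ (fun z => g z p) ⁻¹' {g z p} from rfl) ho
    refine ⟨j, fun z' hz' => hj ?_⟩
    intro i hi
    rw [hz' i hi]
    exact hzw i hi
  let C : (ℕ → ℕ) → (ℕ → ℕ) → Prop := fun M z =>
    g z x = true ∧ ∀ i, g z (y (M (2*i)) (M (2*i+1))) = false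
  have hC : ∀ M z, (∀ j, ∃ M' z', (∀ i < j, M' i = M i) ∧ (∀ i < j, z' i = z i) ∧ C M' z') →
      C M z := by
    intro M z h
    constructor
    · obtain ⟨j, hj⟩ := hloc z x
      obtain ⟨M', z', -, h2, h3⟩ := h j
      rw [← hj z' h2]; exact h3.1
    · intro i
      obtain ⟨j, hj⟩ := hloc z (y (M (2*i)) (M (2*i+1)))
      obtain ⟨M', z', h1, h2, h3⟩ := h (max j (2*i+2))
      rw [← hj z' fun k hk => h2 k (lt_max_of_lt_left hk)]
      have := h3.2 i
      rwa [h1 (2*i) (lt_max_of_lt_right (by omega)),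
        h1 (2*i+1) (lt_max_of_lt_right (by omega))] at this
  rcases ramsey (V := V) C hC with hout | hin
  · refine hout.mono fun M h U hU hxU => ?_
    have : chi U ∈ Set.range g := hr ▸ Set.mem_image_of_mem chi hU
    obtain ⟨z, hz⟩ := this
    by_contra hcon
    push Not at hcon
    refine h z ⟨by rw [hz, hchi]; exact hxU, fun i => ?_⟩
    rw [hz, Bool.eq_false_iff, Ne, hchi]
    exact hcon i
  · exfalso
    obtain ⟨h, hmono, hφ⟩ := diag hV hin
    obtain ⟨L, hL, k, hk⟩ := hx (fun n l => y (h n) (h (n + 1 + l))) (by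
      intro n
      refine (hy (h n)).comp (hmono.tendsto_atTop.comp ?_)
      exact tendsto_atTop_mono (fun l => Nat.le_add_left l (n+1)) tendsto_id)
    have hnext : ∀ b, ∃ n ∈ L, b < n := fun b => hL.exists_gt b
    choose nx hnx1 hnx2 using hnext
    let q : ℕ → ℕ := fun n => Nat.rec (nx 0) (fun _ p => nx (p + 1 + k p)) n
    have hqL : ∀ n, q n ∈ L := by
      intro n; cases n <;> exact hnx1 _
    have hqs : ∀ n, q n + 1 + k (q n) < q (n+1) := fun n => hnx2 _
    have hqm : StrictMono q := strictMono_nat_of_lt_succ fun n => by have := hqs n; omega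
    let φ : ℕ → ℕ := fun n => if n % 2 = 0 then q (n/2) else q (n/2) + 1 + k (q (n/2))
    have he : ∀ i, φ (2*i) = q i := by
      intro i; simp [φ]
    have hod : ∀ i, φ (2*i+1) = q i + 1 + k (q i) := by
      intro i
      have h1 : (2*i+1) % 2 = 1 := by omega
      have h2 : (2*i+1) / 2 = i := by omega
      simp [φ, h1, h2]
    have hφm : StrictMono φ := by
      refine strictMono_nat_of_lt_succ fun n => ?_
      obtain ⟨i, rfl | rfl⟩ := n.even_or_odd'
      · rw [he, hod]; omega
      · rw [hod, show 2*i+1+1 = 2*(i+1) by ring, he]; exact hqs i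
    obtain ⟨z, hz1, hz2⟩ := hφ φ hφm
    have hgz : g z ∈ chi '' {s : Set X | IsOpen s} := hr ▸ Set.mem_range_self z
    obtain ⟨U, hU, hUz⟩ := hgz
    rw [← hUz, hchi] at hz1
    refine Set.infinite_of_injective_forall_mem (f := q) hqm.injective (fun i => ?_)
      (hk U (hU.mem_nhds hz1))
    refine ⟨hqL i, fun hm => ?_⟩
    have := hz2 i
    rw [← hUz, Bool.eq_false_iff, Ne, hchi] at this
    apply this
    simpa only [Function.comp, he, hod] using hm

end WD

theorem stmt13 {X Y : Type*} [Countable X] [Infinite X] [Countable Y] [Infinite Y]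
    [TopologicalSpace X] [TopologicalSpace Y]
    (hX : AnalyticTopology X) (hY : AnalyticTopology Y)
    (hXw : WDSP X) (hYw : WDSP Y) :
    WDSP (X × Y) := by
  rintro ⟨x, x'⟩ y hy
  have hV : ((Filter.hyperfilter ℕ : Ultrafilter ℕ) : Filter ℕ) ≤ Filter.cofinite :=
    Filter.hyperfilter_le_cofinite
  have h1 := WD.one_space hV hX x (hXw x) (fun n k => (y n k).1)
    (fun n => (continuous_fst.tendsto (x, x')).comp (hy n))
  have h2 := WD.one_space hV hY x' (hYw x') (fun n k => (y n k).2)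
    (fun n => (continuous_snd.tendsto (x, x')).comp (hy n))
  obtain ⟨h, hmono, hφ⟩ := WD.diag hV (h1.and h2)
  have pick : ∀ P : ℕ → Prop, {i | P i}.Infinite →
      ∃ φ : ℕ → ℕ, StrictMono φ ∧ ∀ i, ∃ l, P l ∧ φ (2*i) = 2*l ∧ φ (2*i+1) = 2*l+1 := by
    intro P hP
    let q := Nat.nth P
    have hq : StrictMono q := Nat.nth_strictMono hP
    refine ⟨fun n => 2 * q (n/2) + n % 2, strictMono_nat_of_lt_succ fun n => ?_, fun i =>
      ⟨q i, Nat.nth_mem_of_infinite hP i, ?_, ?_⟩⟩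
    · obtain ⟨i, rfl | rfl⟩ := n.even_or_odd'
      · have a1 : (2*i)/2 = i := by omega
        have a2 : (2*i+1)/2 = i := by omega
        rw [a1, a2]; omega
      · have a1 : (2*i+1+1)/2 = i+1 := by omega
        have a2 : (2*i+1)/2 = i := by omega
        have : q i < q (i+1) := hq (Nat.lt_succ_self i)
        rw [a1, a2]; omega
    · have a1 : (2*i)/2 = i := by omega
      simp only [a1]; omega
    · have a2 : (2*i+1)/2 = i := by omega
      simp only [a2]; omega
  have hinj : Function.Injective fun i => h (2*i) := fun i j hij => by
    have := hmono.injective hij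
    omega
  have conv1 : ∀ U : Set X, IsOpen U → x ∈ U →
      {i | (y (h (2*i)) (h (2*i+1))).1 ∉ U}.Finite := by
    intro U hU hxU
    by_contra hinf
    obtain ⟨φ, hφm, hp⟩ := pick _ hinf
    obtain ⟨i, hi⟩ := (hφ φ hφm).1 U hU hxU
    obtain ⟨l, hl, e1, e2⟩ := hp i
    simp only [Function.comp, e1, e2] at hi
    exact hl hi
  have conv2 : ∀ U : Set Y, IsOpen U → x' ∈ U →
      {i | (y (h (2*i)) (h (2*i+1))).2 ∉ U}.Finite := by
    intro U hU hxU
    by_contra hinf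
    obtain ⟨φ, hφm, hp⟩ := pick _ hinf
    obtain ⟨i, hi⟩ := (hφ φ hφm).2 U hU hxU
    obtain ⟨l, hl, e1, e2⟩ := hp i
    simp only [Function.comp, e1, e2] at hi
    exact hl hi
  refine ⟨Set.range fun i => h (2*i), Set.infinite_range_of_injective hinj,
    fun n => h (2 * (Function.invFun (fun i => h (2*i)) n) + 1), ?_⟩
  intro W hW
  obtain ⟨U, U', hU, hxU, hU', hxU', hs⟩ := mem_nhds_prod_iff'.1 hW
  refine (((conv1 U hU hxU).union (conv2 U' hU' hxU')).image fun i => h (2*i)).subset ?_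
  rintro _ ⟨⟨i, rfl⟩, hn⟩
  refine ⟨i, ?_, rfl⟩
  have hinv : Function.invFun (fun i => h (2*i)) (h (2*i)) = i :=
    Function.leftInverse_invFun hinj i
  by_contra hcon
  simp only [Set.mem_union, Set.mem_ofPred_eq, not_or, not_not] at hcon
  apply hn
  dsimp only
  rw [hinv]
  exact hs ⟨hcon.1, hcon.2⟩
end
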